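/- arXiv:0802.1106 — 3 statements merged into one kernel-verified Lean document; each statement's English description precedes it below -/
import Mathlib

section
/- limsup_{n→∞} φ(φ*(n))/n = limsup_{n→∞} φ*(φ(n))/n = limsup_{n→∞} φ*(φ*(n))/n = 1. -/
open Filter Real

/-- The unitary Euler function: `φ*(p₁^{a₁} ⋯ p_r^{a_r}) = ∏ (p_i^{a_i} - 1)`. -/
def uphi (n : ℕ) : ℕ := n.factorization.prod fun p a => p ^ a - 1

/-- A Weierstrass product inequality. -/
lemma one_sub_sum_le_prod_one_sub {ι : Type*} (s : Finset ι) (f : ι → ℝ)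
    (h0 : ∀ i ∈ s, 0 ≤ f i) (h1 : ∀ i ∈ s, f i ≤ 1) :
    1 - ∑ i ∈ s, f i ≤ ∏ i ∈ s, (1 - f i) := by
  classical
  induction s using Finset.induction_on with
  | empty => simp
  | insert a s ha ih =>
    rw [Finset.sum_insert ha, Finset.prod_insert ha]
    have ih' := ih (fun i hi => h0 i (Finset.mem_insert_of_mem hi))
      (fun i hi => h1 i (Finset.mem_insert_of_mem hi))
    have ha0 := h0 a (Finset.mem_insert_self a s)
    have ha1 := h1 a (Finset.mem_insert_self a s)
    have hs : 0 ≤ ∑ i ∈ s, f i :=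
      Finset.sum_nonneg fun i hi => h0 i (Finset.mem_insert_of_mem hi)
    nlinarith [mul_le_mul_of_nonneg_left ih' (sub_nonneg.mpr ha1)]

lemma cast_uphi (n : ℕ) (hn : n ≠ 0) :
    (uphi n : ℝ) = n * ∏ q ∈ n.primeFactors, (1 - 1 / (q : ℝ) ^ n.factorization q) := by
  have h : (n : ℝ) = ∏ q ∈ n.primeFactors, (q : ℝ) ^ n.factorization q := by
    conv_lhs => rw [← Nat.prod_factorization_pow_eq_self hn]
    simp [Finsupp.prod]
  conv_rhs => rw [h]
  rw [← Finset.prod_mul_distrib, uphi, Finsupp.prod, Nat.cast_prod]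
  refine Finset.prod_congr (by simp) fun q hq => ?_
  have hq0 : 0 < q := (Nat.prime_of_mem_primeFactors (by simpa using hq)).pos
  rw [Nat.cast_sub (Nat.one_le_pow _ _ hq0)]
  have : (q : ℝ) ^ n.factorization q ≠ 0 := by positivity
  field_simp
  simp

lemma cast_totient (n : ℕ) :
    (n.totient : ℝ) = n * ∏ q ∈ n.primeFactors, (1 - 1 / (q : ℝ)) := by
  have h := congrArg (fun x : ℚ => (x : ℝ)) (Nat.totient_eq_mul_prod_factors n)
  push_cast at h
  simpa using h

lemma one_div_pow_le_one_of_mem {n q k : ℕ} (hq : q ∈ n.primeFactors) :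
    1 / (q : ℝ) ^ k ≤ 1 := by
  have : (1 : ℝ) ≤ q := by exact_mod_cast (Nat.prime_of_mem_primeFactors hq).one_le
  exact div_le_one_of_le₀ (one_le_pow₀ this) (by positivity)

lemma uphi_le (n : ℕ) (hn : n ≠ 0) : uphi n ≤ n := by
  have h : (uphi n : ℝ) ≤ n := by
    rw [cast_uphi n hn]
    refine mul_le_of_le_one_right (by positivity) (Finset.prod_le_one (fun q hq => ?_) fun q _ => ?_)
    · exact sub_nonneg.mpr (one_div_pow_le_one_of_mem hq)
    · exact sub_le_self _ (by positivity)
  exact_mod_cast h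

lemma uphi_pos (n : ℕ) : 0 < uphi n := by
  unfold uphi Finsupp.prod
  refine Finset.prod_pos fun q hq => ?_
  have hq' : q ∈ n.primeFactors := by simpa using hq
  have hp := Nat.prime_of_mem_primeFactors hq'
  exact Nat.sub_pos_of_lt (Nat.one_lt_pow (Finsupp.mem_support_iff.mp hq) hp.one_lt)

lemma totient_le_uphi (n : ℕ) : n.totient ≤ uphi n := by
  rcases eq_or_ne n 0 with rfl | hn
  · simp
  have h : (n.totient : ℝ) ≤ uphi n := by
    rw [cast_uphi n hn, cast_totient]
    refine mul_le_mul_of_nonneg_left (Finset.prod_le_prod (fun q hq => ?_) fun q hq => ?_)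
      (by positivity)
    · simpa using one_div_pow_le_one_of_mem (k := 1) hq
    · have h1 : (1 : ℝ) ≤ q := by exact_mod_cast (Nat.prime_of_mem_primeFactors hq).one_le
      have h2 : n.factorization q ≠ 0 := by
        rw [← Finsupp.mem_support_iff]; simpa using hq
      have := le_self_pow₀ h1 h2
      have : 1 / (q : ℝ) ^ n.factorization q ≤ 1 / q :=
        one_div_le_one_div_of_le (by positivity) this
      linarith
  exact_mod_cast h

lemma limsup_div_eq_one (g : ℕ → ℕ) (hg : ∀ n, n ≠ 0 → g n ≤ n)
    (h : ∀ ε : ℝ, 0 < ε → ∀ B : ℕ, ∃ n, B ≤ n ∧ 1 - ε ≤ (g n : ℝ) / n) :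
    limsup (fun n : ℕ => (g n : ℝ) / n) atTop = 1 := by
  have hle : ∀ n : ℕ, (g n : ℝ) / n ≤ 1 := fun n => by
    rcases eq_or_ne n 0 with rfl | hn
    · simp
    · exact div_le_one_of_le₀ (by exact_mod_cast hg n hn) (by positivity)
  refine le_antisymm (limsup_le_of_le ⟨0, ?_⟩ (Eventually.of_forall hle)) ?_
  · intro a ha
    obtain ⟨n, hn⟩ := (Filter.eventually_map.mp ha).exists
    exact le_trans (by positivity) hn
  · refine le_of_forall_sub_le fun ε hε => ?_
    refine le_limsup_of_frequently_le (frequently_atTop.mpr fun B => ?_) ⟨1, ?_⟩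
    · obtain ⟨n, hn, hn'⟩ := h ε hε B
      exact ⟨n, hn, hn'⟩
    · exact Filter.eventually_map.mpr (Eventually.of_forall hle)

lemma uphi_prime_pow {p k : ℕ} (hp : p.Prime) (hk : k ≠ 0) : uphi (p ^ k) = p ^ k - 1 := by
  simp [uphi, hp.factorization_pow, Finsupp.prod, Finsupp.support_single, hk]

lemma prime_lt_of_dvd_two_pow_sub_one {p q : ℕ} (hp : p.Prime) (hq : q.Prime)
    (h : q ∣ 2 ^ p - 1) : p < q := by
  have := Fact.mk hq
  have := Fact.mk hp
  have h2 : (2 : ZMod q) ^ p = 1 := by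
    have := (ZMod.natCast_eq_zero_iff _ _).mpr h
    rw [Nat.cast_sub Nat.one_le_two_pow] at this
    push_cast at this
    exact sub_eq_zero.mp this
  have h1 : (2 : ZMod q) ≠ 1 := by
    intro h
    have : (1 : ZMod q) = 0 := by linear_combination h
    exact one_ne_zero this
  have ho : orderOf (2 : ZMod q) = p := orderOf_eq_prime h2 h1
  have hd : p ∣ q - 1 := by
    rw [← ho]
    refine ZMod.orderOf_dvd_card_sub_one ?_
    intro h0
    rw [h0, zero_pow hp.ne_zero] at h2
    exact zero_ne_one h2
  have := Nat.le_of_dvd (Nat.sub_pos_of_lt hq.one_lt) hd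
  have := hq.one_lt
  omega

lemma exists_two_pow_totient (ε : ℝ) (hε : 0 < ε) (B : ℕ) :
    ∃ p : ℕ, p.Prime ∧ B ≤ 2 ^ p ∧ 1 - ε ≤ ((2 ^ p - 1).totient : ℝ) / (2 ^ p : ℕ) := by
  obtain ⟨K, hK⟩ := exists_nat_gt (2 / ε)
  have hK0 : (0 : ℝ) < K := lt_trans (by positivity) hK
  obtain ⟨p, hpB, hp⟩ := Nat.exists_infinite_primes (B + 2 ^ K)
  refine ⟨p, hp, (Nat.le_of_add_right_le hpB).trans Nat.lt_two_pow_self.le, ?_⟩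
  set m := 2 ^ p - 1 with hm
  have hm0 : m ≠ 0 := by
    have := @Nat.lt_two_pow_self p
    have := hp.one_lt
    omega
  have hpp : (0 : ℝ) < p := by exact_mod_cast hp.pos
  have hcard : K * m.primeFactors.card < p := by
    rw [← Nat.pow_lt_pow_iff_right (a := 2) (by norm_num)]
    calc 2 ^ (K * m.primeFactors.card) = ∏ q ∈ m.primeFactors, 2 ^ K := by
          rw [Finset.prod_const, pow_mul]
      _ ≤ ∏ q ∈ m.primeFactors, q := by
          refine Finset.prod_le_prod' fun q hq => ?_
          have := prime_lt_of_dvd_two_pow_sub_one hp (Nat.prime_of_mem_primeFactors hq)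
            (Nat.dvd_of_mem_primeFactors hq)
          omega
      _ ≤ m := Nat.le_of_dvd (Nat.pos_of_ne_zero hm0) (Nat.prod_primeFactors_dvd m)
      _ < 2 ^ p := by omega
  have hsum : ∑ q ∈ m.primeFactors, 1 / (q : ℝ) ≤ 1 / K := by
    calc ∑ q ∈ m.primeFactors, 1 / (q : ℝ) ≤ ∑ q ∈ m.primeFactors, 1 / (p : ℝ) := by
          refine Finset.sum_le_sum fun q hq => one_div_le_one_div_of_le hpp ?_
          exact_mod_cast (prime_lt_of_dvd_two_pow_sub_one hp (Nat.prime_of_mem_primeFactors hq)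
            (Nat.dvd_of_mem_primeFactors hq)).le
      _ = m.primeFactors.card / p := by simp [div_eq_mul_inv]
      _ ≤ 1 / K := by
          rw [div_le_div_iff₀ hpp hK0]
          have : ((K * m.primeFactors.card : ℕ) : ℝ) ≤ p := by exact_mod_cast hcard.le
          push_cast at this
          linarith
  have hprod := one_sub_sum_le_prod_one_sub m.primeFactors (fun q => 1 / (q : ℝ))
    (fun q _ => by positivity)
    (fun q hq => by simpa using one_div_pow_le_one_of_mem (k := 1) hq)
  have h1K : 1 / (K : ℝ) ≤ ε / 2 := by
    rw [div_le_div_iff₀ hK0 two_pos]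
    have := (div_lt_iff₀ hε).mp hK
    linarith
  have h2K : 1 / (2 : ℝ) ^ p ≤ ε / 2 := by
    refine le_trans (one_div_le_one_div_of_le hK0 ?_) h1K
    have : K ≤ 2 ^ p := by
      have := @Nat.lt_two_pow_self p
      have := @Nat.lt_two_pow_self K
      omega
    exact_mod_cast this
  have hmR : (m : ℝ) = 2 ^ p - 1 := by
    rw [hm, Nat.cast_sub Nat.one_le_two_pow]; simp
  rw [cast_totient, hmR]
  push_cast
  set P := ∏ q ∈ m.primeFactors, (1 - 1 / (q : ℝ))
  have hP : P ≤ 1 := Finset.prod_le_one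
    (fun q hq => sub_nonneg.mpr (by simpa using one_div_pow_le_one_of_mem (k := 1) hq))
    (fun q _ => sub_le_self _ (by positivity))
  have h2p : (0 : ℝ) < 2 ^ p := by positivity
  have : (2 ^ p - 1) * P / 2 ^ p = P - 1 / 2 ^ p * P := by field_simp
  rw [this]
  have : 1 / 2 ^ p * P ≤ 1 / (2 : ℝ) ^ p := mul_le_of_le_one_right (by positivity) hP
  linarith

lemma log_four_le_two : log (4 : ℝ) ≤ 2 := by
  have h : (4 : ℝ) = 2 ^ 2 := by norm_num
  rw [h, log_pow]
  have := log_two_lt_d9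
  push_cast
  linarith

lemma factorial_dvd_pow_mul_prod (d N : ℕ) :
    N.factorial ∣ d ^ N * ∏ k ∈ Finset.range N, (d * (k + 1) + 1) := by
  refine (Nat.dvd_iff_prime_pow_dvd_dvd _ _).mpr fun p e hp hpe => ?_
  by_cases hd : p ∣ d
  · have := Fact.mk hp
    have he : e ≤ N := by
      have h1 := (padicValNat_dvd_iff_le N.factorial_ne_zero).mp hpe
      exact h1.trans (padicValNat_factorial_le (p := p) N)
    exact ((pow_dvd_pow p he).trans (pow_dvd_pow_of_dvd hd N)).mul_right _
  · refine Dvd.dvd.mul_left ?_ _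
    have hcop : Nat.Coprime d (p ^ e) := ((hp.coprime_iff_not_dvd.mpr hd).symm).pow_right e
    obtain ⟨c, hc⟩ : ∃ c : ℕ, (d : ZMod (p ^ e)) * c = 1 := by
      have := NeZero.mk (pow_ne_zero e hp.ne_zero)
      refine ⟨((d : ZMod (p ^ e))⁻¹).val, ?_⟩
      rw [ZMod.natCast_zmod_val]
      exact ZMod.coe_mul_inv_eq_one d hcop
    have hasc : (((c + 1).ascFactorial N : ℕ) : ZMod (p ^ e)) = 0 :=
      (ZMod.natCast_eq_zero_iff _ _).mpr (hpe.trans (Nat.factorial_dvd_ascFactorial _ _))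
    rw [← ZMod.natCast_eq_zero_iff]
    have key : ((∏ k ∈ Finset.range N, (d * (k + 1) + 1) : ℕ) : ZMod (p ^ e)) =
        (d : ZMod (p ^ e)) ^ N * ((c + 1).ascFactorial N : ℕ) := by
      rw [Nat.ascFactorial_eq_prod_range]
      push_cast
      have hN : (d : ZMod (p ^ e)) ^ N = ∏ _k ∈ Finset.range N, (d : ZMod (p ^ e)) := by simp
      rw [hN, ← Finset.prod_mul_distrib]
      refine Finset.prod_congr rfl fun k _ => ?_
      linear_combination -hc
    rw [key, hasc, mul_zero]

/-- The logarithm, restricted to the primes congruent to `1` modulo `d`. -/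
noncomputable def logPrimeOne (d n : ℕ) : ℝ := if n.Prime ∧ d ∣ n - 1 then log n else 0

lemma logPrimeOne_nonneg (d n : ℕ) : 0 ≤ logPrimeOne d n := by
  unfold logPrimeOne
  split_ifs
  · exact log_natCast_nonneg n
  · exact le_rfl

/-- The product of the primes in `S` exceeding `N` divides the integer `d ^ N * ∏ (d * k + 1) / N!`;
the remaining ones are bounded by the primorial of `N`. -/
lemma prod_primes_le (d N : ℕ) (hd : 1 ≤ d) (S : Finset ℕ)
    (hS : ∀ n ∈ S, n.Prime ∧ ∃ k < N, n = d * (k + 1) + 1) :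
    ∏ n ∈ S, n ≤ 4 ^ N * (d ^ (2 * N) * (N + 1)) := by
  classical
  rw [← Finset.prod_filter_mul_prod_filter_not S (fun n => n ≤ N)]
  refine Nat.mul_le_mul ?_ ?_
  · refine le_trans (Nat.le_of_dvd (primorial_pos N) ?_) (primorial_le_four_pow N)
    refine Finset.prod_dvd_prod_of_subset _ _ _ fun n hn => ?_
    rw [Finset.mem_filter] at hn
    simpa [Nat.lt_succ_iff] using ⟨hn.2, (hS n hn.1).1⟩
  · set S' := S.filter (fun n => ¬ n ≤ N) with hS'
    have hdvd : ∏ n ∈ S', n ∣ ∏ k ∈ Finset.range N, (d * (k + 1) + 1) := by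
      have hinj : Set.InjOn (fun k => d * (k + 1) + 1) (Finset.range N : Set ℕ) := by
        intro a _ b _ h
        have h1 : d * (a + 1) = d * (b + 1) := by simpa using h
        have := Nat.eq_of_mul_eq_mul_left hd h1
        omega
      rw [← Finset.prod_image (f := fun n => n) hinj]
      refine Finset.prod_dvd_prod_of_subset _ _ _ fun n hn => ?_
      obtain ⟨k, hk, rfl⟩ := (hS n (Finset.mem_filter.mp hn).1).2
      exact Finset.mem_image.mpr ⟨k, Finset.mem_range.mpr hk, rfl⟩
    have hcop : Nat.Coprime (∏ n ∈ S', n) N.factorial := by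
      refine Nat.Coprime.prod_left fun n hn => ?_
      have h := Finset.mem_filter.mp hn
      exact (hS n h.1).1.coprime_factorial_of_lt (not_le.mp h.2)
    have hmul := hcop.mul_dvd_of_dvd_of_dvd (hdvd.mul_left (d ^ N))
      (factorial_dvd_pow_mul_prod d N)
    have hle := Nat.le_of_dvd (by positivity) hmul
    have hup : ∏ k ∈ Finset.range N, (d * (k + 1) + 1) ≤ d ^ N * (N + 1).factorial := by
      calc ∏ k ∈ Finset.range N, (d * (k + 1) + 1)
          ≤ ∏ k ∈ Finset.range N, (d * (k + 1 + 1)) :=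
            Finset.prod_le_prod' fun k _ => by nlinarith
        _ = d ^ N * (N + 1).factorial := by
            rw [Finset.prod_mul_distrib]
            simp [← Finset.prod_range_add_one_eq_factorial, Finset.prod_range_succ']
    refine Nat.le_of_mul_le_mul_right ?_ N.factorial_pos
    calc (∏ n ∈ S', n) * N.factorial ≤ d ^ N * (d ^ N * (N + 1).factorial) :=
          hle.trans (Nat.mul_le_mul_left _ hup)
      _ = d ^ (2 * N) * (N + 1) * N.factorial := by
          rw [Nat.factorial_succ]; ring

/-- A Chebyshev-type upper bound for primes congruent to `1` modulo `d`, uniform in `d`. -/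
lemma sum_logPrimeOne_le (d x : ℕ) (hd : 1 ≤ d) :
    ∑ n ∈ Finset.range (x + 1), logPrimeOne d n ≤ x * ((2 * log d + 3) / d) := by
  classical
  set N := x / d
  set S := (Finset.range (x + 1)).filter (fun n => n.Prime ∧ d ∣ n - 1)
  have hS : ∀ n ∈ S, n.Prime ∧ ∃ k < N, n = d * (k + 1) + 1 := by
    intro n hn
    obtain ⟨hn1, hn2, c, hc⟩ := Finset.mem_filter.mp hn
    have hn3 := hn2.one_lt
    have hc0 : c ≠ 0 := by
      rintro rfl
      omega
    obtain ⟨k, rfl⟩ := Nat.exists_eq_succ_of_ne_zero hc0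
    refine ⟨hn2, k, ?_, by simp only [Nat.succ_eq_add_one] at hc; omega⟩
    have hn4 := Finset.mem_range.mp hn1
    exact (Nat.le_div_iff_mul_le hd).mpr (by rw [mul_comm]; omega)
  have hprod := prod_primes_le d N hd S hS
  have hpos : ∀ n ∈ S, (n : ℝ) ≠ 0 := fun n hn => by exact_mod_cast (hS n hn).1.ne_zero
  have hsum : ∑ n ∈ Finset.range (x + 1), logPrimeOne d n = log ((∏ n ∈ S, n : ℕ) : ℝ) := by
    rw [Nat.cast_prod, log_prod hpos, Finset.sum_filter]
    rfl
  have hd0 : (0 : ℝ) < d := by exact_mod_cast hd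
  have hlogd : 0 ≤ log (d : ℝ) := log_natCast_nonneg d
  rw [hsum]
  have hNx : (N : ℝ) ≤ x / d := Nat.cast_div_le
  calc log ((∏ n ∈ S, n : ℕ) : ℝ) ≤ log ((4 ^ N * (d ^ (2 * N) * (N + 1)) : ℕ) : ℝ) := by
        refine log_le_log ?_ (by exact_mod_cast hprod)
        exact_mod_cast Finset.prod_pos fun n hn => (hS n hn).1.pos
    _ = N * log 4 + (2 * N * log d + log (N + 1)) := by
        push_cast
        rw [log_mul (by positivity) (by positivity), log_mul (by positivity) (by positivity),
          log_pow, log_pow]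
        push_cast
        ring
    _ ≤ N * 2 + (2 * N * log d + N) := by
        have h4 := log_four_le_two
        have hN : log ((N : ℝ) + 1) ≤ N := by
          have := log_le_sub_one_of_pos (show (0 : ℝ) < N + 1 by positivity)
          linarith
        gcongr
    _ = N * (2 * log d + 3) := by ring
    _ ≤ x / d * (2 * log d + 3) := by gcongr
    _ = x * ((2 * log d + 3) / d) := by ring

lemma logPrimeOne_zero (d : ℕ) : logPrimeOne d 0 = 0 := by
  simp [logPrimeOne]

lemma sum_mul_le_of_sum_le (f w : ℕ → ℝ) (A : ℝ) (hw : Antitone w) (hw0 : ∀ n, 0 ≤ w n)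
    (hf : ∀ n, ∑ i ∈ Finset.range n, f i ≤ n * A) (N : ℕ) :
    ∑ i ∈ Finset.range N, f i * w i ≤ A * ∑ i ∈ Finset.range N, w i := by
  have hG : ∀ n, ∑ i ∈ Finset.range n, (f i - A) ≤ 0 := fun n => by
    rw [Finset.sum_sub_distrib]
    simpa using hf n
  have key : ∀ n, ∑ i ∈ Finset.range (n + 1), (f i - A) * w i ≤
      (∑ i ∈ Finset.range (n + 1), (f i - A)) * w n := by
    intro n
    induction n with
    | zero => simp
    | succ n ih =>
      rw [Finset.sum_range_succ, Finset.sum_range_succ (fun i => f i - A), add_mul]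
      have := mul_le_mul_of_nonpos_left (hw n.le_succ) (hG (n + 1))
      linarith
  have h : ∑ i ∈ Finset.range N, (f i - A) * w i ≤ 0 := by
    rcases N with _ | n
    · simp
    · exact (key n).trans (mul_nonpos_of_nonpos_of_nonneg (hG _) (hw0 n))
  simp_rw [sub_mul] at h
  rw [Finset.sum_sub_distrib, ← Finset.mul_sum] at h
  linarith

lemma sum_logPrimeOne_div_rpow_le (d N : ℕ) (hd : 1 ≤ d) (s : ℝ) (hs : 1 < s) :
    ∑ n ∈ Finset.range N, logPrimeOne d n / (n : ℝ) ^ s ≤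
      (2 * log d + 3) / d * ∑' n : ℕ, 1 / (n : ℝ) ^ s := by
  have hsum : Summable fun n : ℕ => 1 / (n : ℝ) ^ s := summable_one_div_nat_rpow.mpr hs
  have hA : 0 ≤ (2 * log (d : ℝ) + 3) / d := by
    have := log_natCast_nonneg d
    positivity
  have habel := sum_mul_le_of_sum_le (fun i => logPrimeOne d (i + 1))
    (fun i => 1 / ((i + 1 : ℕ) : ℝ) ^ s) ((2 * log d + 3) / d)
    (fun a b hab => one_div_le_one_div_of_le (by positivity) (by gcongr))
    (fun n => by positivity)
    (fun n => by
      have := sum_logPrimeOne_le d n hd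
      rwa [Finset.sum_range_succ', logPrimeOne_zero, add_zero] at this) N
  calc ∑ n ∈ Finset.range N, logPrimeOne d n / (n : ℝ) ^ s
      ≤ ∑ n ∈ Finset.range (N + 1), logPrimeOne d n / (n : ℝ) ^ s := by
        rw [Finset.sum_range_succ]
        have := logPrimeOne_nonneg d N
        have : 0 ≤ logPrimeOne d N / (N : ℝ) ^ s := by positivity
        linarith
    _ = ∑ i ∈ Finset.range N, logPrimeOne d (i + 1) * (1 / ((i + 1 : ℕ) : ℝ) ^ s) := by
        rw [Finset.sum_range_succ', logPrimeOne_zero]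
        simp [div_eq_mul_inv]
    _ ≤ _ := habel
    _ ≤ _ := by
        refine mul_le_mul_of_nonneg_left ?_ hA
        refine le_trans ?_ (hsum.sum_le_tsum (Finset.range (N + 1)) fun n _ => by positivity)
        rw [Finset.sum_range_succ' (fun n : ℕ => 1 / (n : ℝ) ^ s)]
        have : 0 ≤ 1 / ((0 : ℕ) : ℝ) ^ s := by positivity
        linarith

lemma residueClass_one_eq (M n : ℕ) (hn : n.Prime) :
    ArithmeticFunction.vonMangoldt.residueClass (1 : ZMod M) n = logPrimeOne M n := by
  have h : (n : ZMod M) = 1 ↔ M ∣ n - 1 := by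
    rw [← ZMod.natCast_eq_zero_iff, Nat.cast_sub hn.one_le, Nat.cast_one, sub_eq_zero]
  simp [ArithmeticFunction.vonMangoldt.residueClass, logPrimeOne, Set.indicator_apply, h, hn,
    ArithmeticFunction.vonMangoldt_apply_prime hn]

lemma logPrimeOne_lower_bound (M : ℕ) (hM : M ≠ 0) :
    ∃ C : ℝ, ∀ s ∈ Set.Ioc (1 : ℝ) 2,
      (M.totient : ℝ)⁻¹ / (s - 1) - C ≤ ∑' n : ℕ, logPrimeOne M n / (n : ℝ) ^ s := by
  have := NeZero.mk hM
  obtain ⟨C, hC⟩ := ArithmeticFunction.vonMangoldt.LSeries_residueClass_lower_bound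
    (isUnit_one : IsUnit (1 : ZMod M))
  have hD := ArithmeticFunction.vonMangoldt.summable_residueClass_non_primes_div (1 : ZMod M)
  set g : ℕ → ℝ := fun n =>
    (if n.Prime then 0 else ArithmeticFunction.vonMangoldt.residueClass (1 : ZMod M) n) / n
  refine ⟨C + ∑' n, g n, fun s hs => ?_⟩
  have hsum : Summable fun n : ℕ => logPrimeOne M n / (n : ℝ) ^ s :=
    summable_of_sum_range_le
      (fun n => div_nonneg (logPrimeOne_nonneg M n) (by positivity))
      (fun N => sum_logPrimeOne_div_rpow_le M N (Nat.one_le_iff_ne_zero.mpr hM) s hs.1)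
  have hle : ∀ n : ℕ, ArithmeticFunction.vonMangoldt.residueClass (1 : ZMod M) n / (n : ℝ) ^ s ≤
      logPrimeOne M n / (n : ℝ) ^ s + g n := by
    intro n
    have hr := ArithmeticFunction.vonMangoldt.residueClass_nonneg (1 : ZMod M) n
    by_cases hn : n.Prime
    · simp [g, hn, residueClass_one_eq M n hn]
    · simp only [logPrimeOne, hn, false_and, if_false, zero_div, zero_add, g]
      rcases n.eq_zero_or_pos with rfl | hn0
      · simp
      · refine div_le_div_of_nonneg_left hr (by exact_mod_cast hn0) ?_
        exact self_le_rpow_of_one_le (by exact_mod_cast hn0) hs.1.le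
  have hle' := (Summable.of_nonneg_of_le (fun n => div_nonneg
    (ArithmeticFunction.vonMangoldt.residueClass_nonneg (1 : ZMod M) n) (by positivity)) hle
    (hsum.add hD)).tsum_le_tsum hle (hsum.add hD)
  rw [hsum.tsum_add hD] at hle'
  linarith [hC hs]

/-- The sum of the reciprocals of the prime factors of `m` exceeding `y`. -/
noncomputable def primeFactorTail (y m : ℕ) : ℝ :=
  ∑ q ∈ m.primeFactors with y < q, 1 / (q : ℝ)

lemma ite_dvd_logPrimeOne_le {M q n : ℕ} (hc : Nat.Coprime q M) :
    (if q ∣ n - 1 then logPrimeOne M n else 0) ≤ logPrimeOne (q * M) n := by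
  split_ifs with h
  · unfold logPrimeOne
    split_ifs with h1 h2 h2
    · exact le_rfl
    · exact absurd ⟨h1.1, hc.mul_dvd_of_dvd_of_dvd h h1.2⟩ h2
    · exact log_natCast_nonneg n
    · exact le_rfl
  · exact logPrimeOne_nonneg _ _

/-- If all primes `p ≡ 1 [MOD M]` had a large tail, comparing the Dirichlet lower bound with the
Chebyshev upper bounds would force `M / φ(M)` to be small. -/
lemma mul_le_mul_totient_of_le_tail (M y : ℕ) (hM : M ≠ 0)
    (hMy : ∀ q : ℕ, q.Prime → q ∣ M → q ≤ y) (ε K : ℝ) (hε : 0 ≤ ε)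
    (hK : ∀ N, ∑ q ∈ Finset.Ioc y N, (2 * log ((q * M : ℕ) : ℝ) + 3) / (q : ℝ) ^ 2 ≤ K)
    (h : ∀ p : ℕ, p.Prime → M ∣ p - 1 → ε ≤ primeFactorTail y (p - 1)) :
    ε * M ≤ K * M.totient := by
  have hM0 : (0 : ℝ) < M := by exact_mod_cast Nat.pos_of_ne_zero hM
  have hφ : (0 : ℝ) < M.totient := by exact_mod_cast Nat.totient_pos.mpr (Nat.pos_of_ne_zero hM)
  obtain ⟨C, hC⟩ := logPrimeOne_lower_bound M hM
  have hfin : ∀ s : ℝ, 1 < s → ∀ N : ℕ,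
      ∑ n ∈ Finset.range N, ε * (logPrimeOne M n / (n : ℝ) ^ s) ≤
        K / M * ∑' n : ℕ, 1 / (n : ℝ) ^ s := by
    intro s hs N
    have hZ : 0 ≤ ∑' n : ℕ, 1 / (n : ℝ) ^ s := tsum_nonneg fun n => by positivity
    calc ∑ n ∈ Finset.range N, ε * (logPrimeOne M n / (n : ℝ) ^ s)
        ≤ ∑ n ∈ Finset.range N, ∑ q ∈ Finset.Ioc y N with q.Prime,
            1 / (q : ℝ) * ((if q ∣ n - 1 then logPrimeOne M n else 0) / (n : ℝ) ^ s) := by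
          refine Finset.sum_le_sum fun n hn => ?_
          by_cases hp : n.Prime ∧ M ∣ n - 1
          · have hn1 := hp.1.one_lt
            have hnN := Finset.mem_range.mp hn
            have htail : primeFactorTail y (n - 1) =
                ∑ q ∈ Finset.Ioc y N with q.Prime, if q ∣ n - 1 then 1 / (q : ℝ) else 0 := by
              rw [primeFactorTail, ← Finset.sum_filter]
              refine Finset.sum_congr ?_ fun _ _ => rfl
              ext q
              simp only [Finset.mem_filter, Nat.mem_primeFactors, Finset.mem_Ioc]
              constructor
              · rintro ⟨⟨h1, h2, h3⟩, h4⟩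
                have := Nat.le_of_dvd (Nat.pos_of_ne_zero h3) h2
                exact ⟨⟨⟨h4, by omega⟩, h1⟩, h2⟩
              · rintro ⟨⟨⟨h1, h2⟩, h3⟩, h4⟩
                exact ⟨⟨h3, h4, by omega⟩, h1⟩
            have h0 : 0 ≤ logPrimeOne M n / (n : ℝ) ^ s :=
              div_nonneg (logPrimeOne_nonneg M n) (by positivity)
            refine (mul_le_mul_of_nonneg_right (h n hp.1 hp.2) h0).trans (le_of_eq ?_)
            rw [htail, Finset.sum_mul]
            refine Finset.sum_congr rfl fun q _ => ?_
            split_ifs <;> simp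
          · simp [logPrimeOne, hp]
      _ = ∑ q ∈ Finset.Ioc y N with q.Prime, 1 / (q : ℝ) * ∑ n ∈ Finset.range N,
            (if q ∣ n - 1 then logPrimeOne M n else 0) / (n : ℝ) ^ s := by
          rw [Finset.sum_comm]
          simp_rw [Finset.mul_sum]
      _ ≤ ∑ q ∈ Finset.Ioc y N with q.Prime, 1 / (q : ℝ) *
            ((2 * log ((q * M : ℕ) : ℝ) + 3) / ((q * M : ℕ) : ℝ) *
              ∑' n : ℕ, 1 / (n : ℝ) ^ s) := by
          refine Finset.sum_le_sum fun q hq => mul_le_mul_of_nonneg_left ?_ (by positivity)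
          obtain ⟨hq1, hq2⟩ := Finset.mem_filter.mp hq
          have hc : Nat.Coprime q M := hq2.coprime_iff_not_dvd.mpr fun hd =>
            absurd (hMy q hq2 hd) (not_le.mpr (Finset.mem_Ioc.mp hq1).1)
          refine le_trans (Finset.sum_le_sum fun n _ => ?_)
            (sum_logPrimeOne_div_rpow_le (q * M) N
              (Nat.mul_pos hq2.pos (Nat.pos_of_ne_zero hM)) s hs)
          exact div_le_div_of_nonneg_right (ite_dvd_logPrimeOne_le hc) (by positivity)
      _ ≤ ∑ q ∈ Finset.Ioc y N, 1 / (q : ℝ) *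
            ((2 * log ((q * M : ℕ) : ℝ) + 3) / ((q * M : ℕ) : ℝ) *
              ∑' n : ℕ, 1 / (n : ℝ) ^ s) := by
          refine Finset.sum_le_sum_of_subset_of_nonneg (Finset.filter_subset _ _) fun q _ _ => ?_
          have := log_natCast_nonneg (q * M)
          positivity
      _ = (∑ q ∈ Finset.Ioc y N, (2 * log ((q * M : ℕ) : ℝ) + 3) / (q : ℝ) ^ 2) / M *
            ∑' n : ℕ, 1 / (n : ℝ) ^ s := by
          rw [Finset.sum_div, Finset.sum_mul]
          refine Finset.sum_congr rfl fun q _ => ?_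
          rw [Nat.cast_mul, ← mul_assoc, div_mul_div_comm, div_div, one_mul]
          ring_nf
      _ ≤ K / M * ∑' n : ℕ, 1 / (n : ℝ) ^ s := by
          gcongr
          exact hK N
  have hbound : ∀ s ∈ Set.Ioc (1 : ℝ) 2, ε * ((M.totient : ℝ)⁻¹ - C * (s - 1)) ≤
      K / M * ((s - 1) * ∑' n : ℕ, 1 / (n : ℝ) ^ s) := by
    intro s hs
    have h1 := tsum_le_of_sum_range_le (fun n => mul_nonneg hε
      (div_nonneg (logPrimeOne_nonneg M n) (by positivity))) (hfin s hs.1)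
    rw [tsum_mul_left] at h1
    have hs0 : 0 < s - 1 := sub_pos.mpr hs.1
    have h2 := (mul_le_mul_of_nonneg_left (hC s hs) hε).trans h1
    have h3 := mul_le_mul_of_nonneg_left h2 hs0.le
    calc ε * ((M.totient : ℝ)⁻¹ - C * (s - 1))
        = (s - 1) * (ε * ((M.totient : ℝ)⁻¹ / (s - 1) - C)) := by field_simp
      _ ≤ _ := h3
      _ = _ := by ring
  have hlim1 : Tendsto (fun s : ℝ => ε * ((M.totient : ℝ)⁻¹ - C * (s - 1)))
      (nhdsWithin 1 (Set.Ioi 1)) (nhds (ε * ((M.totient : ℝ)⁻¹ - C * (1 - 1)))) :=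
    (Continuous.tendsto (by fun_prop) 1).mono_left nhdsWithin_le_nhds
  have hlim2 := tendsto_sub_mul_tsum_nat_rpow.const_mul (K / M)
  have hev : ∀ᶠ s in nhdsWithin (1 : ℝ) (Set.Ioi 1), s ∈ Set.Ioc (1 : ℝ) 2 :=
    Ioc_mem_nhdsGT (by norm_num)
  have hfinal := le_of_tendsto_of_tendsto hlim1 hlim2 (hev.mono hbound)
  rw [sub_self, mul_zero, sub_zero, mul_one, ← div_eq_mul_inv, div_le_div_iff₀ hφ hM0] at hfinal
  exact hfinal

lemma summable_log_add_three_div_sq :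
    Summable fun n : ℕ => (2 * log (n : ℝ) + 3) / (n : ℝ) ^ 2 := by
  have h : Summable fun n : ℕ => 7 * (1 / (n : ℝ) ^ (3 / 2 : ℝ)) :=
    (summable_one_div_nat_rpow.mpr (by norm_num)).mul_left 7
  refine Summable.of_nonneg_of_le (fun n => ?_) (fun n => ?_) h
  · have := log_natCast_nonneg n
    positivity
  · rcases n.eq_zero_or_pos with rfl | hn
    · simp
    have hn0 : (0 : ℝ) < n := by exact_mod_cast hn
    have hn1 : (1 : ℝ) ≤ n := by exact_mod_cast hn
    have h1 : log (n : ℝ) ≤ (n : ℝ) ^ (1 / 2 : ℝ) / (1 / 2) :=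
      log_le_rpow_div hn0.le (by norm_num)
    have h2 : (1 : ℝ) ≤ (n : ℝ) ^ (1 / 2 : ℝ) := one_le_rpow hn1 (by norm_num)
    have h3 : (n : ℝ) ^ 2 = (n : ℝ) ^ (1 / 2 : ℝ) * (n : ℝ) ^ (3 / 2 : ℝ) := by
      rw [← rpow_add hn0]
      norm_num
    calc (2 * log (n : ℝ) + 3) / (n : ℝ) ^ 2
        ≤ (7 * (n : ℝ) ^ (1 / 2 : ℝ)) / (n : ℝ) ^ 2 := by
          gcongr
          linarith
      _ = 7 * (1 / (n : ℝ) ^ (3 / 2 : ℝ)) := by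
          rw [h3]
          field_simp

lemma sum_Ioc_log_mul_div_sq_le (M y N : ℕ) (hM : M ≠ 0) (hy : y ≠ 0)
    (hMy : log (M : ℝ) ≤ 5 * y) :
    ∑ q ∈ Finset.Ioc y N, (2 * log ((q * M : ℕ) : ℝ) + 3) / (q : ℝ) ^ 2 ≤
      ∑' n : ℕ, (2 * log (n : ℝ) + 3) / (n : ℝ) ^ 2 + 10 := by
  have hy0 : (0 : ℝ) < y := by exact_mod_cast Nat.pos_of_ne_zero hy
  have hM0 : (M : ℝ) ≠ 0 := by exact_mod_cast hM
  have hsq : ∑ q ∈ Finset.Ioc y N, ((q : ℝ) ^ 2)⁻¹ ≤ (y : ℝ)⁻¹ := by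
    rcases le_total y N with h | h
    · refine (sum_Ioc_inv_sq_le_sub hy h).trans (sub_le_self _ (by positivity))
    · rw [Finset.Ioc_eq_empty_of_le h]
      simp
  calc ∑ q ∈ Finset.Ioc y N, (2 * log ((q * M : ℕ) : ℝ) + 3) / (q : ℝ) ^ 2
      = ∑ q ∈ Finset.Ioc y N, (2 * log (q : ℝ) + 3) / (q : ℝ) ^ 2 +
          2 * log M * ∑ q ∈ Finset.Ioc y N, ((q : ℝ) ^ 2)⁻¹ := by
        rw [Finset.mul_sum, ← Finset.sum_add_distrib]
        refine Finset.sum_congr rfl fun q hq => ?_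
        have hq0 : (q : ℝ) ≠ 0 := by
          have := (Finset.mem_Ioc.mp hq).1
          exact_mod_cast (by omega : q ≠ 0)
        rw [Nat.cast_mul, log_mul hq0 hM0]
        ring
    _ ≤ ∑' n : ℕ, (2 * log (n : ℝ) + 3) / (n : ℝ) ^ 2 + 2 * (5 * y) * (y : ℝ)⁻¹ := by
        refine add_le_add ?_ ?_
        · refine summable_log_add_three_div_sq.sum_le_tsum _ fun n _ => ?_
          have := log_natCast_nonneg n
          positivity
        · have := log_natCast_nonneg M
          gcongr
    _ = _ := by
        field_simp
        ring

lemma tendsto_prod_primesLE_one_sub :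
    Tendsto (fun y : ℕ => ∏ p ∈ Nat.primesLE y, (1 - 1 / (p : ℝ))) atTop (nhds 0) := by
  have hdiv : Tendsto (fun y : ℕ => ∑ n ∈ Finset.range y,
      Set.indicator {p : ℕ | p.Prime} (fun n : ℕ => (1 : ℝ) / n) n) atTop atTop :=
    (not_summable_iff_tendsto_nat_atTop_of_nonneg
      (fun n => Set.indicator_nonneg (fun n _ => by positivity) n)).mp
      not_summable_one_div_on_primes
  have hexp := (tendsto_exp_neg_atTop_nhds_zero.comp hdiv).comp (tendsto_add_atTop_nat 1)
  refine squeeze_zero (fun y => ?_) (fun y => ?_) hexp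
  · refine Finset.prod_nonneg fun p hp => ?_
    have h1 : (1 : ℝ) ≤ p := by exact_mod_cast (Nat.mem_primesLE.mp hp).2.one_le
    exact sub_nonneg.mpr (div_le_one_of_le₀ h1 (by positivity))
  · simp only [Function.comp_apply]
    have hS : ∑ n ∈ Finset.range (y + 1),
        Set.indicator {p : ℕ | p.Prime} (fun n : ℕ => (1 : ℝ) / n) n =
        ∑ p ∈ Nat.primesLE y, 1 / (p : ℝ) := by
      simp only [Set.indicator_apply, Set.mem_ofPred_eq]
      rw [← Finset.sum_filter]
      refine Finset.sum_congr ?_ fun _ _ => rfl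
      ext p
      simp [Nat.mem_primesLE]
    rw [hS, ← Finset.sum_neg_distrib, exp_sum]
    refine Finset.prod_le_prod (fun p hp => ?_) fun p _ => ?_
    · have h1 : (1 : ℝ) ≤ p := by exact_mod_cast (Nat.mem_primesLE.mp hp).2.one_le
      exact sub_nonneg.mpr (div_le_one_of_le₀ h1 (by positivity))
    · have := add_one_le_exp (-(1 / (p : ℝ)))
      linarith

/-- An integer divisible by the square of every prime up to `y`, and by a high power of every
prime up to `z`. -/
def highPowerModulus (z y : ℕ) : ℕ := z.factorial ^ (2 * z) * primorial y ^ 2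

lemma highPowerModulus_ne_zero (z y : ℕ) : highPowerModulus z y ≠ 0 :=
  mul_ne_zero (pow_ne_zero _ z.factorial_ne_zero) (pow_ne_zero _ (primorial_ne_zero y))

lemma primeFactors_highPowerModulus {z y : ℕ} (hzy : z ≤ y) :
    (highPowerModulus z y).primeFactors = Nat.primesLE y := by
  ext q
  simp only [Nat.mem_primeFactors, Nat.mem_primesLE]
  constructor
  · rintro ⟨hq, hd, -⟩
    refine ⟨?_, hq⟩
    rcases hq.dvd_mul.mp hd with h | h
    · exact ((hq.dvd_factorial).mp (hq.dvd_of_dvd_pow h)).trans hzy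
    · exact hq.dvd_primorial_iff.mp (hq.dvd_of_dvd_pow h)
  · rintro ⟨hqy, hq⟩
    exact ⟨hq, ((hq.dvd_primorial_iff.mpr hqy).pow two_ne_zero).mul_left _,
      highPowerModulus_ne_zero z y⟩

lemma log_highPowerModulus_le {z y : ℕ} (hy : log ((z.factorial ^ (2 * z) : ℕ) : ℝ) ≤ y) :
    log (highPowerModulus z y : ℝ) ≤ 5 * y := by
  have h1 : ((z.factorial ^ (2 * z) : ℕ) : ℝ) ≠ 0 := by
    exact_mod_cast pow_ne_zero _ z.factorial_ne_zero
  have h2 : (((primorial y) ^ 2 : ℕ) : ℝ) ≠ 0 := by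
    exact_mod_cast pow_ne_zero 2 (primorial_ne_zero y)
  have h3 : log (primorial y : ℝ) ≤ y * 2 := by
    calc log (primorial y : ℝ) ≤ log ((4 : ℝ) ^ y) :=
          log_le_log (by exact_mod_cast primorial_pos y)
            (by exact_mod_cast primorial_le_four_pow y)
      _ = y * log 4 := log_pow _ _
      _ ≤ y * 2 := by
          have := log_four_le_two
          gcongr
  have h5 : log (((primorial y) ^ 2 : ℕ) : ℝ) = 2 * log (primorial y : ℝ) := by
    push_cast
    rw [log_pow]
    push_cast
    rfl
  rw [highPowerModulus, Nat.cast_mul, log_mul h1 h2, h5]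
  linarith

lemma exists_prime_tail_lt (z : ℕ) (ε : ℝ) (hε : 0 < ε) :
    ∃ y p : ℕ, z ≤ y ∧ p.Prime ∧ highPowerModulus z y ∣ p - 1 ∧
      primeFactorTail y (p - 1) < ε := by
  set K := ∑' n : ℕ, (2 * log (n : ℝ) + 3) / (n : ℝ) ^ 2 + 10
  have hK : 0 < K := by
    have : 0 ≤ ∑' n : ℕ, (2 * log (n : ℝ) + 3) / (n : ℝ) ^ 2 := tsum_nonneg fun n => by
      have := log_natCast_nonneg n
      positivity
    positivity
  have hlim := tendsto_prod_primesLE_one_sub.eventually_lt_const (div_pos hε hK)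
  obtain ⟨y, hy, hyz, hy1, hyT⟩ := (hlim.and ((eventually_ge_atTop z).and
    ((eventually_ge_atTop 1).and (tendsto_natCast_atTop_atTop.eventually_ge_atTop
      (log ((z.factorial ^ (2 * z) : ℕ) : ℝ)))))).exists
  by_contra! hcon
  set M := highPowerModulus z y with hMdef
  have hM : M ≠ 0 := highPowerModulus_ne_zero z y
  have hle := mul_le_mul_totient_of_le_tail M y hM
    (fun q hq hqM => by
      have : q ∈ M.primeFactors := Nat.mem_primeFactors.mpr ⟨hq, hqM, hM⟩
      rw [hMdef, primeFactors_highPowerModulus hyz] at this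
      exact (Nat.mem_primesLE.mp this).1) ε K hε.le
    (fun N => sum_Ioc_log_mul_div_sq_le M y N hM (by omega) (log_highPowerModulus_le hyT))
    (fun p hp hMp => hcon y p hyz hp hMp)
  rw [cast_totient, hMdef, primeFactors_highPowerModulus hyz, ← hMdef] at hle
  have hM0 : (0 : ℝ) < M := by exact_mod_cast Nat.pos_of_ne_zero hM
  rw [lt_div_iff₀ hK] at hy
  nlinarith [mul_lt_mul_of_pos_left hy hM0]

lemma sum_one_div_pow_factorization_le {z y m : ℕ} (hz : z ≠ 0) (hm : m ≠ 0)
    (hzy : z ≤ y) (hd : highPowerModulus z y ∣ m) :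
    ∑ q ∈ m.primeFactors, 1 / (q : ℝ) ^ m.factorization q ≤
      2 / z + primeFactorTail y m := by
  classical
  have hz0 : (0 : ℝ) < z := by exact_mod_cast Nat.pos_of_ne_zero hz
  have hbound : ∀ q ∈ m.primeFactors, ∀ k, q ^ k ∣ m →
      1 / (q : ℝ) ^ m.factorization q ≤ 1 / (q : ℝ) ^ k := by
    intro q hq k hk
    have hqp := Nat.prime_of_mem_primeFactors hq
    have h1 : (1 : ℝ) ≤ q := by exact_mod_cast hqp.one_le
    refine one_div_le_one_div_of_le (by positivity) (pow_le_pow_right₀ h1 ?_)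
    exact (hqp.pow_dvd_iff_le_factorization hm).mp hk
  rw [← Finset.sum_filter_not_add_sum_filter m.primeFactors (fun q => y < q)]
  refine add_le_add ?_ ?_
  · rw [← Finset.sum_filter_add_sum_filter_not (m.primeFactors.filter (fun q => ¬ y < q))
      (fun q => q ≤ z)]
    have hsmall : ∑ q ∈ (m.primeFactors.filter (fun q => ¬ y < q)) with q ≤ z,
        1 / (q : ℝ) ^ m.factorization q ≤ 1 / z := by
      have hterm : ∀ q ∈ (m.primeFactors.filter (fun q => ¬ y < q)).filter (fun q => q ≤ z),
          1 / (q : ℝ) ^ m.factorization q ≤ 1 / (z : ℝ) ^ 2 := by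
        intro q hq
        simp only [Finset.mem_filter] at hq
        obtain ⟨⟨hq1, -⟩, hqz⟩ := hq
        have hqp := Nat.prime_of_mem_primeFactors hq1
        refine (hbound q hq1 (2 * z) (dvd_trans ?_ hd)).trans ?_
        · exact (pow_dvd_pow_of_dvd (hqp.dvd_factorial.mpr hqz) _).mul_right _
        · refine one_div_le_one_div_of_le (by positivity) ?_
          have h2 : z ^ 2 ≤ q ^ (2 * z) := by
            calc z ^ 2 ≤ (2 ^ z) ^ 2 := Nat.pow_le_pow_left Nat.lt_two_pow_self.le 2
              _ = 2 ^ (2 * z) := by rw [← pow_mul, mul_comm]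
              _ ≤ q ^ (2 * z) := Nat.pow_le_pow_left hqp.two_le _
          exact_mod_cast h2
      have hcard : ((m.primeFactors.filter (fun q => ¬ y < q)).filter (fun q => q ≤ z)).card ≤
          z := by
        have hsub : (m.primeFactors.filter (fun q => ¬ y < q)).filter (fun q => q ≤ z) ⊆
            Finset.Ioc 0 z := by
          intro q hq
          simp only [Finset.mem_filter] at hq
          exact Finset.mem_Ioc.mpr ⟨(Nat.prime_of_mem_primeFactors hq.1.1).pos, hq.2⟩
        simpa using Finset.card_le_card hsub
      calc _ ≤ _ := Finset.sum_le_card_nsmul _ _ _ hterm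
        _ ≤ z * (1 / (z : ℝ) ^ 2) := by
          rw [nsmul_eq_mul]
          gcongr
        _ = 1 / z := by field_simp
    have hmid : ∑ q ∈ (m.primeFactors.filter (fun q => ¬ y < q)) with ¬ q ≤ z,
        1 / (q : ℝ) ^ m.factorization q ≤ 1 / z := by
      calc _ ≤ ∑ q ∈ (m.primeFactors.filter (fun q => ¬ y < q)) with ¬ q ≤ z,
            ((q : ℝ) ^ 2)⁻¹ := by
            refine Finset.sum_le_sum fun q hq => ?_
            simp only [Finset.mem_filter] at hq
            obtain ⟨⟨hq1, hqy⟩, -⟩ := hq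
            have hqp := Nat.prime_of_mem_primeFactors hq1
            rw [← one_div]
            refine hbound q hq1 2 (dvd_trans ?_ hd)
            exact (pow_dvd_pow_of_dvd (hqp.dvd_primorial_iff.mpr (not_lt.mp hqy)) 2).mul_left _
        _ ≤ ∑ q ∈ Finset.Ioc z y, ((q : ℝ) ^ 2)⁻¹ := by
            refine Finset.sum_le_sum_of_subset_of_nonneg (fun q hq => ?_)
              fun q _ _ => by positivity
            simp only [Finset.mem_filter] at hq
            exact Finset.mem_Ioc.mpr ⟨not_le.mp hq.2, not_lt.mp hq.1.2⟩
        _ ≤ 1 / z := by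
            rw [one_div]
            exact (sum_Ioc_inv_sq_le_sub hz hzy).trans (sub_le_self _ (by positivity))
    calc _ ≤ 1 / (z : ℝ) + 1 / z := add_le_add hsmall hmid
      _ = 2 / z := by ring
  · refine Finset.sum_le_sum fun q hq => ?_
    have hq1 := (Finset.mem_filter.mp hq).1
    simpa using hbound q hq1 1 (by simpa using Nat.dvd_of_mem_primeFactors hq1)

lemma exists_prime_uphi_sub_one (ε : ℝ) (hε : 0 < ε) (B : ℕ) :
    ∃ p : ℕ, p.Prime ∧ B ≤ p ∧ 1 - ε ≤ (uphi (p - 1) : ℝ) / p := by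
  obtain ⟨z₀, hz₀⟩ := exists_nat_gt (6 / ε)
  set z := z₀ + B with hz
  have hz0R : (0 : ℝ) < z₀ := lt_trans (by positivity) hz₀
  have hzε : 6 / ε < z := by
    rw [hz]
    push_cast
    have : (0 : ℝ) ≤ B := by positivity
    linarith
  have hz0 : z ≠ 0 := by
    have : 0 < z₀ := by exact_mod_cast hz0R
    omega
  obtain ⟨y, p, hzy, hp, hd, htail⟩ := exists_prime_tail_lt z (ε / 3) (by positivity)
  have hp1 := hp.one_lt
  have hm0 : p - 1 ≠ 0 := by omega
  have hzp : z ≤ p := by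
    have h1 : z ≤ z.factorial := Nat.self_le_factorial z
    have h2 : z.factorial ∣ p - 1 :=
      ((dvd_pow_self _ (by omega)).mul_right _).trans hd
    have := Nat.le_of_dvd (Nat.pos_of_ne_zero hm0) h2
    omega
  refine ⟨p, hp, by omega, ?_⟩
  have hsum := sum_one_div_pow_factorization_le hz0 hm0 hzy hd
  have hprod := one_sub_sum_le_prod_one_sub (p - 1).primeFactors
    (fun q => 1 / (q : ℝ) ^ (p - 1).factorization q) (fun q _ => by positivity)
    (fun q hq => one_div_pow_le_one_of_mem hq)
  have hzR : (0 : ℝ) < z := by exact_mod_cast Nat.pos_of_ne_zero hz0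
  have hpR : (0 : ℝ) < p := by exact_mod_cast hp.pos
  have h2z : 2 / (z : ℝ) ≤ ε / 3 := by
    rw [div_le_div_iff₀ hzR (by norm_num)]
    have := (div_lt_iff₀ hε).mp hzε
    linarith
  have h1p : 1 / (p : ℝ) ≤ ε / 3 := by
    refine le_trans ?_ h2z
    have hzp' : (z : ℝ) ≤ p := by exact_mod_cast hzp
    calc 1 / (p : ℝ) ≤ 1 / z := one_div_le_one_div_of_le hzR hzp'
      _ ≤ 2 / z := by gcongr; norm_num
  rw [cast_uphi _ hm0, Nat.cast_sub hp1.le]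
  set P := ∏ q ∈ (p - 1).primeFactors, (1 - 1 / (q : ℝ) ^ (p - 1).factorization q)
  have hP : P ≤ 1 := Finset.prod_le_one
    (fun q hq => sub_nonneg.mpr (one_div_pow_le_one_of_mem hq))
    (fun q _ => sub_le_self _ (by positivity))
  have heq : ((p : ℝ) - (1 : ℕ)) * P / p = P - 1 / p * P := by
    push_cast
    field_simp
  rw [heq]
  have : 1 / (p : ℝ) * P ≤ 1 / p := mul_le_of_le_one_right (by positivity) hP
  linarith

theorem limsup_phi_uphi_comps :
    limsup (fun n : ℕ => (Nat.totient (uphi n) : ℝ) / n) atTop = 1 ∧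
    limsup (fun n : ℕ => (uphi (Nat.totient n) : ℝ) / n) atTop = 1 ∧
    limsup (fun n : ℕ => (uphi (uphi n) : ℝ) / n) atTop = 1 := by
  refine ⟨limsup_div_eq_one (fun n => (uphi n).totient) (fun n hn => ?_) fun ε hε B => ?_,
    limsup_div_eq_one (fun n => uphi n.totient) (fun n hn => ?_) fun ε hε B => ?_,
    limsup_div_eq_one (fun n => uphi (uphi n)) (fun n hn => ?_) fun ε hε B => ?_⟩
  · exact (Nat.totient_le _).trans (uphi_le n hn)
  · obtain ⟨p, hp, hB, h⟩ := exists_two_pow_totient ε hε B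
    refine ⟨2 ^ p, hB, ?_⟩
    rwa [uphi_prime_pow Nat.prime_two hp.ne_zero]
  · exact (uphi_le _ (Nat.totient_pos.mpr (Nat.pos_of_ne_zero hn)).ne').trans (Nat.totient_le n)
  · obtain ⟨p, hp, hB, h⟩ := exists_prime_uphi_sub_one ε hε B
    refine ⟨p, hB, ?_⟩
    rwa [Nat.totient_prime hp]
  · exact (uphi_le _ (uphi_pos n).ne').trans (uphi_le n hn)
  · obtain ⟨p, hp, hB, h⟩ := exists_two_pow_totient ε hε B
    refine ⟨2 ^ p, hB, h.trans ?_⟩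
    rw [uphi_prime_pow Nat.prime_two hp.ne_zero]
    gcongr
    exact totient_le_uphi _
end

section
/- liminf_{n→∞} σ*(φ*(n))/n ≤ inf { σ*(φ*(m/2))/(m/2) : m a positive even integer with m ≠ 2^ℓ for every ℓ ≥ 2 }. -/
open Filter Real

/-- The sum of the unitary divisors of `n`: `σ*(p₁^{a₁} ⋯ p_r^{a_r}) = ∏ (p_i^{a_i} + 1)`. -/
def usigma (n : ℕ) : ℕ := n.factorization.prod fun p a => p ^ a + 1

theorem factorial_dvd_pow_mul_prod_add (m a n : ℕ) :
    n.factorial ∣ m ^ n * ∏ k ∈ Finset.range n, (m * (k + 1) + a) := by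
  rw [Nat.dvd_iff_prime_pow_dvd_dvd]
  intro p k hp hk
  by_cases hpm : p ∣ m
  · have h1 : k ≤ n.factorial.factorization p :=
      (hp.pow_dvd_iff_le_factorization n.factorial_ne_zero).1 hk
    have h2 := Nat.factorization_factorial_le_div_pred hp n
    have h3 : n / (p - 1) ≤ n := Nat.div_le_self _ _
    exact Dvd.dvd.mul_right ((pow_dvd_pow p (by omega)).trans (pow_dvd_pow_of_dvd hpm n)) _
  · have hcop : m.Coprime (p ^ k) := (((Nat.Prime.coprime_iff_not_dvd hp).2 hpm).pow_left k).symm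
    apply Dvd.dvd.mul_left
    obtain ⟨u, hu⟩ := (ZMod.isUnit_iff_coprime m (p ^ k)).2 hcop
    have : NeZero (p ^ k) := ⟨pow_ne_zero _ hp.ne_zero⟩
    obtain ⟨b, hb⟩ := ZMod.natCast_zmod_surjective ((↑u⁻¹ : ZMod (p ^ k)) * (a : ZMod (p ^ k)))
    have hmb : (m : ZMod (p ^ k)) * b = a := by rw [hb, ← hu, Units.mul_inv_cancel_left]
    have hasc : p ^ k ∣ (b + 1).ascFactorial n :=
      hk.trans (Nat.factorial_dvd_ascFactorial _ _)
    rw [← ZMod.natCast_eq_zero_iff, Nat.ascFactorial_eq_prod_range] at hasc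
    rw [← ZMod.natCast_eq_zero_iff]
    have : ((∏ k ∈ Finset.range n, (m * (k + 1) + a) : ℕ) : ZMod (p ^ k)) =
        m ^ n * ((∏ i ∈ Finset.range n, (b + 1 + i) : ℕ) : ZMod (p ^ k)) := by
      push_cast
      rw [← Finset.card_range n, ← Finset.prod_const, Finset.card_range,
        ← Finset.prod_mul_distrib]
      refine Finset.prod_congr rfl fun i _ => ?_
      rw [← hmb]; ring
    rw [this, hasc, mul_zero]

theorem prod_mul_add_le (m a n : ℕ) (ha : a ≤ m) :
    ∏ k ∈ Finset.range n, (m * (k + 1) + a) ≤ m ^ n * (n + 1).factorial := by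
  induction n with
  | zero => simp
  | succ n ih =>
    rw [Finset.prod_range_succ, Nat.factorial_succ (n + 1), pow_succ]
    calc _ ≤ (m ^ n * (n + 1).factorial) * (m * (n + 1) + m) := by gcongr
      _ = _ := by ring

theorem prod_primes_modEq_le {T : Finset ℕ} {m n a : ℕ} (ha : a ≤ m)
    (hT : ∀ q ∈ T, q.Prime ∧ n < q ∧ ∃ k < n, q = m * (k + 1) + a) (hm : 0 < m) :
    ∏ q ∈ T, q ≤ (2 * m ^ 2) ^ n := by
  have hP := factorial_dvd_pow_mul_prod_add m a n
  set P := ∏ k ∈ Finset.range n, (m * (k + 1) + a) with hPdef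
  have hQ : ∏ q ∈ T, q ∣ P := by
    refine Finset.prod_primes_dvd _ (fun q hq => (hT q hq).1.prime) fun q hq => ?_
    obtain ⟨k, hk, rfl⟩ := (hT q hq).2.2
    exact Finset.dvd_prod_of_mem (fun k => m * (k + 1) + a) (Finset.mem_range.2 hk)
  have hcop : (∏ q ∈ T, q).Coprime n.factorial := by
    refine Nat.Coprime.prod_left fun q hq => ?_
    rw [(hT q hq).1.coprime_iff_not_dvd, (hT q hq).1.dvd_factorial]
    exact not_le.2 (hT q hq).2.1
  have hdvd := hcop.mul_dvd_of_dvd_of_dvd (hQ.mul_left (m ^ n)) hP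
  have hPpos : 0 < P := Finset.prod_pos fun k _ => by positivity
  have hle := Nat.le_of_dvd (by positivity) hdvd
  have hn : n + 1 ≤ 2 ^ n := Nat.lt_two_pow_self
  refine Nat.le_of_mul_le_mul_right (c := n.factorial) ?_ n.factorial_pos
  calc _ ≤ m ^ n * P := hle
    _ ≤ m ^ n * (m ^ n * ((n + 1) * n.factorial)) := by
      rw [← Nat.factorial_succ]; gcongr; exact prod_mul_add_le m a n ha
    _ ≤ m ^ n * (m ^ n * (2 ^ n * n.factorial)) := by gcongr
    _ = _ := by rw [mul_pow]; ring

/-- A Chebyshev-type bound for primes in a residue class, uniform in the modulus. -/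
theorem sum_log_primes_modEq_le {T : Finset ℕ} {m X : ℕ} (hm : 0 < m)
    (hp : ∀ q ∈ T, q.Prime) (hX : ∀ q ∈ T, q ≤ X)
    (hmod : ∀ q ∈ T, ∀ q' ∈ T, q ≡ q' [MOD m]) :
    ∑ q ∈ T, log q ≤ log X + X / m * log (8 * m ^ 2) := by
  have hm1 : (1 : ℝ) ≤ m := by exact_mod_cast hm
  have hlog8 : 0 ≤ log (8 * (m : ℝ) ^ 2) := log_nonneg (by nlinarith)
  rcases T.eq_empty_or_nonempty with rfl | ⟨q₀, hq₀⟩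
  · rw [Finset.sum_empty]
    have := log_natCast_nonneg X
    positivity
  set n := X / m with hn
  have hnX : (n : ℝ) ≤ X / m := Nat.cast_div_le
  have hsmall : ∑ q ∈ T with q < m, log q ≤ log X := by
    have hcard : (T.filter (· < m)).card ≤ 1 := by
      rw [Finset.card_le_one]
      intro q hq q' hq'
      rw [Finset.mem_filter] at hq hq'
      exact Nat.ModEq.eq_of_lt_of_lt (hmod q hq.1 q' hq'.1) hq.2 hq'.2
    calc _ ≤ ∑ q ∈ T with q < m, log X := by
          refine Finset.sum_le_sum fun q hq => ?_
          rw [Finset.mem_filter] at hq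
          exact log_le_log (by exact_mod_cast (hp q hq.1).pos) (by exact_mod_cast hX q hq.1)
      _ = (T.filter (· < m)).card * log X := by rw [Finset.sum_const, nsmul_eq_mul]
      _ ≤ 1 * log X := by
          gcongr
          exact_mod_cast hcard
      _ = _ := one_mul _
  have hmid : ∑ q ∈ (T.filter (¬ · < m)) with q ≤ n, log q ≤ n * log 4 := by
    rw [mul_comm]
    refine le_trans ?_ (Chebyshev.theta_le_log4_mul_x (Nat.cast_nonneg n))
    rw [Chebyshev.theta_eq_sum_primesLE_log]
    refine Finset.sum_le_sum_of_subset_of_nonneg (fun q hq => ?_)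
      fun q _ _ => log_natCast_nonneg q
    simp only [Finset.mem_filter] at hq
    rw [Nat.mem_primesLE]
    exact ⟨hq.2, hp q hq.1.1⟩
  have hbig : ∑ q ∈ (T.filter (¬ · < m)) with ¬ q ≤ n, log q ≤ n * log (2 * m ^ 2) := by
    rw [← Real.log_prod (fun q hq => ?_), ← Real.log_pow]
    · have h := prod_primes_modEq_le (T := (T.filter (¬ · < m)).filter (¬ · ≤ n)) (m := m)
        (n := n) (a := q₀ % m) (Nat.mod_lt _ hm).le (fun q hq => ?_) hm
      · have h' := (Nat.cast_le (α := ℝ)).2 h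
        push_cast at h'
        refine log_le_log ?_ h'
        refine Finset.prod_pos fun q hq => ?_
        simp only [Finset.mem_filter] at hq
        exact_mod_cast (hp q hq.1.1).pos
      · simp only [Finset.mem_filter, not_lt, not_le] at hq
        obtain ⟨⟨hqT, hqm⟩, hqn⟩ := hq
        refine ⟨hp q hqT, hqn, q / m - 1, ?_, ?_⟩
        · have h1 : q / m ≤ n := Nat.div_le_div_right (hX q hqT)
          have h2 : 1 ≤ q / m := (Nat.one_le_div_iff hm).2 hqm
          omega
        · have h2 : 1 ≤ q / m := (Nat.one_le_div_iff hm).2 hqm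
          rw [Nat.sub_add_cancel h2, ← show q % m = q₀ % m from hmod q hqT q₀ hq₀]
          exact (Nat.div_add_mod q m).symm
    · simp only [Finset.mem_filter] at hq
      exact_mod_cast (hp q hq.1.1).ne_zero
  have hlog : log (8 * (m : ℝ) ^ 2) = log 4 + log (2 * m ^ 2) := by
    rw [← log_mul (by norm_num) (by positivity)]; ring_nf
  rw [← Finset.sum_filter_add_sum_filter_not T (· < m),
    ← Finset.sum_filter_add_sum_filter_not (T.filter (¬ · < m)) (· ≤ n)]
  have := mul_le_mul_of_nonneg_right hnX hlog8
  rw [hlog] at this ⊢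
  linarith

/-- Abel summation against `n ^ (-s)`, for a sequence with linearly bounded partial sums. -/
theorem sum_mul_rpow_le {f : ℕ → ℝ} {c K s : ℝ} (hs : 0 ≤ s)
    (h : ∀ n, ∑ i ∈ Finset.range n, f (i + 1) ≤ c * n + K) (n : ℕ) :
    ∑ i ∈ Finset.range n, f (i + 1) / ((i + 1 : ℕ) : ℝ) ^ s ≤
      c * ∑ i ∈ Finset.range n, 1 / ((i + 1 : ℕ) : ℝ) ^ s + K := by
  have key : ∑ i ∈ Finset.range n, f (i + 1) / ((i + 1 : ℕ) : ℝ) ^ s +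
      (c * n + K - ∑ i ∈ Finset.range n, f (i + 1)) / ((n + 1 : ℕ) : ℝ) ^ s ≤
      c * ∑ i ∈ Finset.range n, 1 / ((i + 1 : ℕ) : ℝ) ^ s + K := by
    induction n with
    | zero => simp
    | succ n ih =>
      refine le_trans ?_ (add_le_add_right ih (c / ((n + 1 : ℕ) : ℝ) ^ s) |>.trans_eq ?_)
      · rw [Finset.sum_range_succ, Finset.sum_range_succ _ n]
        have hD := sub_nonneg.2 (h (n + 1))
        have : (c * (n + 1 : ℕ) + K - ∑ i ∈ Finset.range (n + 1), f (i + 1)) /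
            ((n + 1 + 1 : ℕ) : ℝ) ^ s ≤ (c * (n + 1 : ℕ) + K -
              ∑ i ∈ Finset.range (n + 1), f (i + 1)) / ((n + 1 : ℕ) : ℝ) ^ s := by
          gcongr
          omega
        rw [Finset.sum_range_succ] at this
        refine le_trans (add_le_add_right this _) (le_of_eq ?_)
        push_cast
        ring
      · rw [Finset.sum_range_succ]; ring
  have := div_nonneg (sub_nonneg.2 (h n)) (rpow_nonneg (Nat.cast_nonneg (α := ℝ) (n + 1)) s)
  linarith

open ArithmeticFunction.vonMangoldt in
/-- The von Mangoldt sum over an invertible class modulo `M` has upper density at least `1 / φ(M)`. -/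
theorem not_eventually_sum_residueClass_le {M : ℕ} [NeZero M] {a : ZMod M} (ha : IsUnit a)
    {c : ℝ} (hc : c < (M.totient : ℝ)⁻¹) :
    ¬ ∀ᶠ n : ℕ in atTop, ∑ i ∈ Finset.range n, residueClass a (i + 1) ≤ c * n := by
  intro h
  obtain ⟨n₀, hn₀⟩ := eventually_atTop.1 h
  wlog hc0 : 0 ≤ c generalizing c
  · refine this (c := 0) ?_ ?_ (fun n hn => ?_) le_rfl
    · have : 0 < M.totient := Nat.totient_pos.2 (NeZero.pos M)
      positivity
    · filter_upwards [h] with n hn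
      refine hn.trans ?_
      rw [zero_mul]
      exact mul_nonpos_of_nonpos_of_nonneg (not_le.1 hc0).le (Nat.cast_nonneg n)
    · refine (hn₀ n hn).trans ?_
      rw [zero_mul]
      exact mul_nonpos_of_nonpos_of_nonneg (not_le.1 hc0).le (Nat.cast_nonneg n)
  set K := ∑ i ∈ Finset.range n₀, residueClass a (i + 1) with hKdef
  have hK : 0 ≤ K := Finset.sum_nonneg fun i _ => residueClass_nonneg a _
  have hb : ∀ n : ℕ, ∑ i ∈ Finset.range n, residueClass a (i + 1) ≤ c * n + K := by
    intro n
    rcases le_total n₀ n with hn | hn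
    · linarith [hn₀ n hn]
    · have h1 : ∑ i ∈ Finset.range n, residueClass a (i + 1) ≤ K :=
        Finset.sum_le_sum_of_subset_of_nonneg (Finset.range_mono hn)
          fun i _ _ => residueClass_nonneg a _
      have : 0 ≤ c * n := by positivity
      linarith
  have hup : ∀ s : ℝ, 1 < s →
      ∑' n, residueClass a n / (n : ℝ) ^ s ≤ c * ∑' n : ℕ, 1 / (n : ℝ) ^ s + K := by
    intro s hs
    have hsum : Summable fun n : ℕ => 1 / (n : ℝ) ^ s := summable_one_div_nat_rpow.2 hs
    refine Real.tsum_le_of_sum_range_le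
      (fun n => div_nonneg (residueClass_nonneg a n) (by positivity)) fun n => ?_
    refine le_trans (Finset.sum_le_sum_of_subset_of_nonneg
      (Finset.range_mono n.le_succ) fun i _ _ =>
        div_nonneg (residueClass_nonneg a i) (by positivity)) ?_
    rw [Finset.sum_range_succ', residueClass_apply_zero, zero_div, add_zero]
    refine (sum_mul_rpow_le (by linarith) hb n).trans ?_
    gcongr
    have := hsum.sum_le_tsum (Finset.range (n + 1)) (fun i _ => by positivity)
    rw [Finset.sum_range_succ'] at this
    refine le_trans ?_ this
    simp only [le_add_iff_nonneg_right]
    positivity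
  obtain ⟨C, hC⟩ := LSeries_residueClass_lower_bound ha
  have hlim : Tendsto (fun s : ℝ => c * ((s - 1) * ∑' n : ℕ, 1 / (n : ℝ) ^ s) + (s - 1) * (K + C))
      (nhdsWithin 1 (Set.Ioi 1)) (nhds (c * 1 + (1 - 1) * (K + C))) := by
    refine (tendsto_sub_mul_tsum_nat_rpow.const_mul c).add ?_
    refine Tendsto.mono_left ?_ nhdsWithin_le_nhds
    exact ((continuous_id.sub continuous_const).mul continuous_const).tendsto 1
  have hle : (M.totient : ℝ)⁻¹ ≤ c * 1 + (1 - 1) * (K + C) := by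
    refine ge_of_tendsto hlim ?_
    have hmem : Set.Ioc (1 : ℝ) 2 ∈ nhdsWithin (1 : ℝ) (Set.Ioi 1) := Ioc_mem_nhdsGT (by norm_num)
    filter_upwards [hmem] with s hs
    have h1 := (hC hs).trans (hup s hs.1)
    have hs1 : 0 < s - 1 := sub_pos.2 hs.1
    rw [sub_le_iff_le_add, div_le_iff₀ hs1] at h1
    linarith
  linarith

theorem exists_totient_primorial_le {η : ℝ} (hη : 0 < η) :
    ∃ y : ℕ, 2 ≤ y ∧ ((4 * primorial y).totient : ℝ) ≤ η * (4 * primorial y : ℕ) := by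
  have hnon : ∀ n : ℕ, 0 ≤ Set.indicator {p : ℕ | p.Prime} (fun n : ℕ => (1 : ℝ) / n) n :=
    fun n => Set.indicator_nonneg (fun _ _ => by positivity) n
  have hdiv := (not_summable_iff_tendsto_nat_atTop_of_nonneg hnon).1
    not_summable_one_div_on_primes
  obtain ⟨y, hy, hy2⟩ := ((hdiv.eventually_ge_atTop (-log η)).and
    (eventually_ge_atTop 3)).exists
  refine ⟨y, by omega, ?_⟩
  have hpf : (4 * primorial y).primeFactors = Nat.primesLE y := by
    rw [Nat.primeFactors_mul (by norm_num) (primorial_ne_zero y), primeFactors_primorial,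
      show 4 = 2 ^ 2 by norm_num, Nat.primeFactors_prime_pow (by norm_num) Nat.prime_two,
      Finset.union_eq_right, Finset.singleton_subset_iff, Nat.mem_primesLE]
    exact ⟨by omega, Nat.prime_two⟩
  have h := Nat.totient_eq_mul_prod_factors (4 * primorial y)
  rw [hpf] at h
  have h' : ((4 * primorial y).totient : ℝ) = (4 * primorial y : ℕ) *
      ∏ p ∈ Nat.primesLE y, (1 - (p : ℝ)⁻¹) := by
    have h2 := congrArg (Rat.cast (K := ℝ)) h
    push_cast at h2 ⊢
    exact h2
  rw [h', mul_comm]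
  gcongr
  calc ∏ p ∈ Nat.primesLE y, (1 - (p : ℝ)⁻¹) ≤ ∏ p ∈ Nat.primesLE y, exp (-(p : ℝ)⁻¹) := by
        refine Finset.prod_le_prod (fun p hp => ?_) fun p _ => ?_
        · have : (1 : ℝ) ≤ p := by
            exact_mod_cast (Nat.mem_primesLE.1 hp).2.one_le
          exact sub_nonneg.2 (inv_le_one_of_one_le₀ this)
        · linarith [add_one_le_exp (-(p : ℝ)⁻¹)]
    _ = exp (-∑ p ∈ Nat.primesLE y, (p : ℝ)⁻¹) := by
        rw [← exp_sum, Finset.sum_neg_distrib]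
    _ ≤ exp (log η) := by
        gcongr
        rw [neg_le]
        refine hy.trans ?_
        rw [Finset.sum_indicator_eq_sum_filter]
        simp only [one_div]
        refine Finset.sum_le_sum_of_subset_of_nonneg (fun p hp => ?_) fun _ _ _ => by positivity
        simp only [Finset.mem_filter, Finset.mem_range, Set.mem_ofPred_eq] at hp
        exact Nat.mem_primesLE.2 ⟨hp.1.le, hp.2⟩
    _ = η := exp_log hη

theorem sum_Ioc_inv_mul_le : ∃ C : ℝ, 0 ≤ C ∧ ∀ y X : ℕ, 1 ≤ y →
    ∑ l ∈ Finset.Ioc y X, (l : ℝ)⁻¹ * (log X + X / (l * (4 * primorial y) : ℕ) *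
      log (8 * ((l * (4 * primorial y) : ℕ) : ℝ) ^ 2)) ≤
    log X * (1 + log X) + X * (C / (4 * primorial y : ℕ)) := by
  have hsumm : Summable fun n : ℕ => 1 / (n : ℝ) ^ (3 / 2 : ℝ) :=
    summable_one_div_nat_rpow.2 (by norm_num)
  set S := ∑' n : ℕ, 1 / (n : ℝ) ^ (3 / 2 : ℝ) with hS
  have hS0 : 0 ≤ S := tsum_nonneg fun n => by positivity
  have hlog8 : 0 ≤ log 8 := log_nonneg (by norm_num)
  have hlog4 : 0 ≤ log 4 := log_nonneg (by norm_num)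
  refine ⟨(log 8 + 4) * S + 4 * log 4, by positivity, fun y X hy => ?_⟩
  set M := 4 * primorial y with hM
  have hMpos : 0 < M := by have := primorial_pos y; omega
  have hMpos' : (0 : ℝ) < M := by exact_mod_cast hMpos
  have hlogM : log M ≤ (y + 1) * log 4 := by
    have h1 : M ≤ 4 ^ (y + 1) := by
      rw [pow_succ, mul_comm]; exact Nat.mul_le_mul_left 4 (primorial_le_four_pow y)
    have h2 : log M ≤ log ((4 : ℝ) ^ (y + 1)) := log_le_log hMpos' (by exact_mod_cast h1)
    rw [log_pow] at h2
    exact_mod_cast h2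
  have hlogX : 0 ≤ log (X : ℝ) := log_natCast_nonneg X
  have hterm : ∀ l ∈ Finset.Ioc y X, (l : ℝ)⁻¹ * (log X + X / (l * M : ℕ) *
      log (8 * ((l * M : ℕ) : ℝ) ^ 2)) ≤ log X * (l : ℝ)⁻¹ + X / M * ((log 8 + 4) *
        (1 / (l : ℝ) ^ (3 / 2 : ℝ)) + 2 * (y + 1) * log 4 * ((l : ℝ) ^ 2)⁻¹) := by
    intro l hl
    have hl1 : (1 : ℝ) ≤ l := by
      have := (Finset.mem_Ioc.1 hl).1
      exact_mod_cast (by omega : 1 ≤ l)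
    have hl0 : (0 : ℝ) < l := by linarith
    have hloge : log (8 * ((l * M : ℕ) : ℝ) ^ 2) = log 8 + 2 * log l + 2 * log M := by
      push_cast
      rw [log_mul (by norm_num) (by positivity), log_pow, log_mul hl0.ne' hMpos'.ne']
      push_cast; ring
    have hlogl : log (l : ℝ) ≤ 2 * (l : ℝ) ^ (1 / 2 : ℝ) := by
      have := log_le_rpow_div hl0.le (show (0 : ℝ) < 1 / 2 by norm_num)
      linarith
    have hr : 1 / (l : ℝ) ^ (3 / 2 : ℝ) = (l : ℝ) ^ (1 / 2 : ℝ) * ((l : ℝ) ^ 2)⁻¹ := by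
      rw [one_div, ← rpow_neg hl0.le, ← rpow_natCast, ← rpow_neg hl0.le, ← rpow_add hl0]
      norm_num
    have hhalf : 1 ≤ (l : ℝ) ^ (1 / 2 : ℝ) := one_le_rpow hl1 (by norm_num)
    have hmain : log (8 * ((l * M : ℕ) : ℝ) ^ 2) ≤
        (log 8 + 4) * (l : ℝ) ^ (1 / 2 : ℝ) + 2 * (y + 1) * log 4 := by
      rw [hloge]
      nlinarith
    calc _ = log X * (l : ℝ)⁻¹ +
          X / M * (log (8 * ((l * M : ℕ) : ℝ) ^ 2) * ((l : ℝ) ^ 2)⁻¹) := by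
          push_cast
          field_simp
      _ ≤ log X * (l : ℝ)⁻¹ + X / M * (((log 8 + 4) * (l : ℝ) ^ (1 / 2 : ℝ) +
          2 * (y + 1) * log 4) * ((l : ℝ) ^ 2)⁻¹) := by gcongr
      _ = _ := by rw [hr]; ring
  refine (Finset.sum_le_sum hterm).trans ?_
  rw [Finset.sum_add_distrib, ← Finset.mul_sum, ← Finset.mul_sum, Finset.sum_add_distrib,
    ← Finset.mul_sum, ← Finset.mul_sum]
  have hharm : ∑ l ∈ Finset.Ioc y X, (l : ℝ)⁻¹ ≤ 1 + log X := by
    have h := harmonic_le_one_add_log X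
    rw [harmonic_eq_sum_Icc] at h
    push_cast at h
    refine le_trans (Finset.sum_le_sum_of_subset_of_nonneg (fun l hl => ?_)
      fun _ _ _ => by positivity) h
    rw [Finset.mem_Ioc] at hl
    exact Finset.mem_Icc.2 ⟨by omega, hl.2⟩
  have h32 : ∑ l ∈ Finset.Ioc y X, 1 / (l : ℝ) ^ (3 / 2 : ℝ) ≤ S :=
    hsumm.sum_le_tsum _ fun _ _ => by positivity
  have hsq : (y + 1) * ∑ l ∈ Finset.Ioc y X, ((l : ℝ) ^ 2)⁻¹ ≤ (2 : ℝ) := by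
    have hy' : (1 : ℝ) ≤ y := by exact_mod_cast hy
    rcases le_total y X with hyX | hyX
    · have h := sum_Ioc_inv_sq_le_sub (α := ℝ) (by omega : y ≠ 0) hyX
      have hX0 : (0 : ℝ) ≤ (X : ℝ)⁻¹ := by positivity
      calc _ ≤ ((y : ℝ) + 1) * (y : ℝ)⁻¹ := by gcongr; linarith
        _ ≤ 2 := by
          rw [← div_eq_mul_inv, div_le_iff₀ (by linarith)]; linarith
    · rw [Finset.Ioc_eq_empty_of_le hyX]; simp
  calc _ ≤ log X * (1 + log X) + X / M * ((log 8 + 4) * S + 2 * log 4 * 2) := by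
        gcongr ?_ + _ * (?_ + ?_)
        · gcongr
        · gcongr
        · calc _ = 2 * log 4 * ((y + 1) * ∑ l ∈ Finset.Ioc y X, ((l : ℝ) ^ 2)⁻¹) := by ring
            _ ≤ _ := by gcongr
    _ = _ := by ring

theorem sum_log_mul_sum_inv_primeFactors_le {y X : ℕ} (hy : 2 ≤ y) {T : Finset ℕ}
    (hp : ∀ q ∈ T, q.Prime) (hX : ∀ q ∈ T, q ≤ X) (hT : ∀ q ∈ T, 4 * primorial y ∣ q + 1) :
    ∑ q ∈ T, log q * ∑ l ∈ (q - 1).primeFactors.erase 2, (l : ℝ)⁻¹ ≤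
      ∑ l ∈ Finset.Ioc y X, (l : ℝ)⁻¹ * (log X + X / (l * (4 * primorial y) : ℕ) *
      log (8 * ((l * (4 * primorial y) : ℕ) : ℝ) ^ 2)) := by
  set M := 4 * primorial y with hM
  have hMpos : 0 < M := by have := primorial_pos y; omega
  have hsub : ∀ q ∈ T, (q - 1).primeFactors.erase 2 ⊆
      (Finset.Ioc y X).filter (fun l => l.Prime ∧ l ∣ q - 1) := by
    intro q hq l hl
    rw [Finset.mem_erase, Nat.mem_primeFactors] at hl
    obtain ⟨hl2, hlp, hlq, hq0⟩ := hl
    have hlle := Nat.le_of_dvd (Nat.pos_of_ne_zero hq0) hlq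
    have := hX q hq
    simp only [Finset.mem_filter, Finset.mem_Ioc]
    refine ⟨⟨?_, by omega⟩, hlp, hlq⟩
    by_contra hly
    have h1 : l ∣ M := (hlp.dvd_primorial_iff.2 (not_lt.1 hly)).mul_left 4
    have h2 : l ∣ (q + 1) - (q - 1) := Nat.dvd_sub (h1.trans (hT q hq)) hlq
    have h3 : (q + 1) - (q - 1) = 2 := by omega
    rw [h3] at h2
    exact hl2 ((Nat.prime_dvd_prime_iff_eq hlp Nat.prime_two).1 h2)
  calc _ ≤ ∑ q ∈ T, log q * ∑ l ∈ Finset.Ioc y X with l.Prime ∧ l ∣ q - 1, (l : ℝ)⁻¹ := by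
        refine Finset.sum_le_sum fun q hq => ?_
        refine mul_le_mul_of_nonneg_left ?_ (log_natCast_nonneg q)
        exact Finset.sum_le_sum_of_subset_of_nonneg (hsub q hq) fun _ _ _ => by positivity
    _ = ∑ l ∈ Finset.Ioc y X, (l : ℝ)⁻¹ * ∑ q ∈ T with l.Prime ∧ l ∣ q - 1, log q := by
        simp only [Finset.sum_filter, Finset.mul_sum]
        rw [Finset.sum_comm]
        refine Finset.sum_congr rfl fun l _ => Finset.sum_congr rfl fun q _ => ?_
        split_ifs <;> ring
    _ ≤ _ := by
        refine Finset.sum_le_sum fun l hl => mul_le_mul_of_nonneg_left ?_ (by positivity)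
        rw [Finset.mem_Ioc] at hl
        refine sum_log_primes_modEq_le (Nat.mul_pos (by omega) hMpos)
          (fun q hq => hp q (Finset.mem_filter.1 hq).1)
          (fun q hq => hX q (Finset.mem_filter.1 hq).1) fun q hq q' hq' => ?_
        rw [Finset.mem_filter] at hq hq'
        have hlp := hq.2.1
        have hcop : l.Coprime M := by
          rw [hlp.coprime_iff_not_dvd, hM, hlp.dvd_mul, not_or, hlp.dvd_primorial_iff]
          refine ⟨fun h => ?_, by omega⟩
          have : l ∣ 2 := hlp.dvd_of_dvd_pow (show l ∣ 2 ^ 2 from h)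
          have := Nat.le_of_dvd (by norm_num) this
          omega
        rw [← Nat.modEq_and_modEq_iff_modEq_mul hcop]
        constructor
        · exact (((Nat.modEq_iff_dvd' (hp q hq.1).one_le).2 hq.2.2).symm).trans
            ((Nat.modEq_iff_dvd' (hp q' hq'.1).one_le).2 hq'.2.2)
        · refine Nat.ModEq.add_right_cancel' 1 ?_
          exact ((Nat.modEq_zero_iff_dvd.2 (hT q hq.1))).trans
            (Nat.modEq_zero_iff_dvd.2 (hT q' hq'.1)).symm

theorem eventually_sqrt_log_error_le (A K : ℝ) {c : ℝ} (hc : 0 < c) :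
    ∀ᶠ n : ℕ in atTop,
      2 * √n * log n + K + A * (log n * (1 + log n)) ≤ c * n := by
  have h1 : (fun x : ℝ => √x * log x) =o[atTop] (fun x : ℝ => x) := by
    have h := (Asymptotics.isBigO_refl (fun x : ℝ => √x) atTop).mul_isLittleO
      (isLittleO_log_rpow_atTop (show (0 : ℝ) < 1 / 2 by norm_num))
    refine h.congr' EventuallyEq.rfl ?_
    filter_upwards [eventually_ge_atTop 0] with x hx
    rw [← sqrt_eq_rpow, mul_self_sqrt hx]
  have h2 : (fun x : ℝ => log x ^ 2) =o[atTop] (fun x : ℝ => x) := isLittleO_pow_log_id_atTop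
  have h3 : (fun x : ℝ => log x) =o[atTop] (fun x : ℝ => x) := isLittleO_log_id_atTop
  have h4 : (fun _ : ℝ => K) =o[atTop] (fun x : ℝ => x) := Asymptotics.isLittleO_const_id_atTop K
  have h := (((h1.const_mul_left 2).add h4).add ((h3.add h2).const_mul_left A)).bound hc
  filter_upwards [tendsto_natCast_atTop_atTop.eventually h] with n hn
  rw [norm_of_nonneg (Nat.cast_nonneg n)] at hn
  refine le_trans (le_of_eq ?_) ((le_norm_self _).trans hn)
  ring

theorem sum_Ioc_eq_sum_range_succ (f : ℕ → ℝ) (n : ℕ) :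
    ∑ i ∈ Finset.range n, f (i + 1) = ∑ i ∈ Finset.Ioc 0 n, f i := by
  induction n with
  | zero => simp
  | succ n ih => rw [Finset.sum_range_succ, ih, Finset.sum_Ioc_succ_top (Nat.zero_le n)]

open ArithmeticFunction.vonMangoldt in
theorem sum_residueClass_le {M : ℕ} (a : ZMod M) (N n : ℕ) (hn : 1 ≤ n) :
    ∑ i ∈ Finset.range n, residueClass a (i + 1) ≤ 2 * √n * log n + ∑ i ∈ Finset.range (N + 1),
      log i + ∑ q ∈ Finset.Ioc 0 n with q.Prime ∧ N < q ∧ (q : ZMod M) = a, log q := by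
  rw [sum_Ioc_eq_sum_range_succ]
  have hpt : ∀ i ∈ Finset.Ioc 0 n, residueClass a i ≤
      (if ¬ i.Prime then ArithmeticFunction.vonMangoldt i else 0) + (if i ≤ N then log i else 0) +
      (if i.Prime ∧ N < i ∧ (i : ZMod M) = a then log i else 0) := by
    intro i _
    have h0 : 0 ≤ log (i : ℝ) := log_natCast_nonneg i
    by_cases hi : i.Prime
    · by_cases hN : i ≤ N
      · have := residueClass_le a i
        rw [ArithmeticFunction.vonMangoldt_apply_prime hi] at this
        simpa [hi, hN, not_lt.2 hN] using this
      · by_cases ha : (i : ZMod M) = a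
        · have := residueClass_le a i
          rw [ArithmeticFunction.vonMangoldt_apply_prime hi] at this
          simpa [hi, hN, ha, not_le.1 hN] using this
        · simp [hi, hN, ha, residueClass]
    · have := residueClass_le a i
      simp only [hi, not_false_eq_true, if_true, false_and, if_false, add_zero]
      split_ifs <;> linarith
  refine (Finset.sum_le_sum hpt).trans ?_
  rw [Finset.sum_add_distrib, Finset.sum_add_distrib, ← Finset.sum_filter, ← Finset.sum_filter,
    ← Finset.sum_filter]
  gcongr ?_ + ?_ + _
  · have h := Chebyshev.psi_sub_theta_le (x := n) (by exact_mod_cast hn)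
    rw [Chebyshev.psi_sub_theta_eq_sum_not_prime, Nat.floor_natCast] at h
    exact h
  · refine Finset.sum_le_sum_of_subset_of_nonneg (fun i hi => ?_) fun i _ _ => log_natCast_nonneg i
    rw [Finset.mem_filter] at hi
    exact Finset.mem_range.2 (by omega)

/-- There are arbitrarily large primes `q ≡ 3 (mod 4)` for which the sum of the reciprocals of the
odd prime factors of `q - 1` is small. -/
theorem exists_prime_sum_inv_primeFactors_le {ε : ℝ} (hε : 0 < ε) (N : ℕ) :
    ∃ q : ℕ, q.Prime ∧ N < q ∧ q % 4 = 3 ∧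
      ∑ l ∈ (q - 1).primeFactors.erase 2, (l : ℝ)⁻¹ ≤ ε := by
  by_contra! hcon
  obtain ⟨C, hC0, hC⟩ := sum_Ioc_inv_mul_le
  obtain ⟨y, hy, hφ⟩ := exists_totient_primorial_le (η := ε / (2 * (C + 1))) (by positivity)
  have hC := fun X => hC y X (by omega)
  set M := 4 * primorial y with hM
  have hMpos : 0 < M := by have := primorial_pos y; omega
  have : NeZero M := ⟨hMpos.ne'⟩
  have hM' : (0 : ℝ) < M := by exact_mod_cast hMpos
  have hφ0 : (0 : ℝ) < M.totient := by exact_mod_cast Nat.totient_pos.2 hMpos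
  have hCM : ε⁻¹ * (C / M) ≤ (M.totient : ℝ)⁻¹ / 2 := by
    have h1 : (M.totient : ℝ) * (2 * C) ≤ ε * M := by
      calc _ ≤ (M.totient : ℝ) * (2 * (C + 1)) := by gcongr; linarith
        _ ≤ ε / (2 * (C + 1)) * M * (2 * (C + 1)) := by gcongr
        _ = _ := by field_simp
    rw [show ε⁻¹ * (C / M) = C / (ε * M) by field_simp, show (M.totient : ℝ)⁻¹ / 2 =
      1 / (M.totient * 2) by field_simp, div_le_div_iff₀ (by positivity) (by positivity)]
    linarith
  refine not_eventually_sum_residueClass_le (M := M) (a := -1) isUnit_one.neg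
    (c := (M.totient : ℝ)⁻¹ * (3 / 4)) ?_ ?_
  · have := inv_pos.2 hφ0
    linarith
  filter_upwards [eventually_ge_atTop 1, eventually_sqrt_log_error_le ε⁻¹
    (∑ i ∈ Finset.range (N + 1), log i) (show 0 < (M.totient : ℝ)⁻¹ / 4 by positivity)]
    with n hn1 hn
  refine (sum_residueClass_le (-1 : ZMod M) N n hn1).trans ?_
  set T := (Finset.Ioc 0 n).filter (fun q => q.Prime ∧ N < q ∧ (q : ZMod M) = -1) with hT
  have hTdvd : ∀ q ∈ T, M ∣ q + 1 := by
    intro q hq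
    have := (Finset.mem_filter.1 hq).2.2.2
    rw [← ZMod.natCast_eq_zero_iff]
    push_cast
    rw [this, neg_add_cancel]
  have hTp : ∀ q ∈ T, q.Prime := fun q hq => (Finset.mem_filter.1 hq).2.1
  have hsum := (sum_log_mul_sum_inv_primeFactors_le hy hTp
    (fun q hq => (Finset.mem_Ioc.1 (Finset.mem_filter.1 hq).1).2) hTdvd).trans (hC n)
  have hlow : ε * ∑ q ∈ T, log q ≤
      ∑ q ∈ T, log q * ∑ l ∈ (q - 1).primeFactors.erase 2, (l : ℝ)⁻¹ := by
    rw [Finset.mul_sum]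
    refine Finset.sum_le_sum fun q hq => ?_
    rw [mul_comm]
    refine mul_le_mul_of_nonneg_left (hcon q (hTp q hq) (Finset.mem_filter.1 hq).2.2.1 ?_).le
      (log_natCast_nonneg q)
    have : 4 ∣ q + 1 := (Dvd.intro _ rfl : 4 ∣ M).trans (hTdvd q hq)
    omega
  have hfin : ∑ q ∈ T, log q ≤ ε⁻¹ * (log n * (1 + log n) + n * (C / M)) := by
    rw [← div_eq_inv_mul, le_div_iff₀ hε, mul_comm]
    exact hlow.trans hsum
  have hmul := mul_le_mul_of_nonneg_right hCM (Nat.cast_nonneg (α := ℝ) n)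
  have hexp : ε⁻¹ * (log n * (1 + log n) + n * (C / M)) =
      ε⁻¹ * (log n * (1 + log n)) + ε⁻¹ * (C / M) * n := by ring
  rw [hexp] at hfin
  linarith

theorem usigma_mul_of_coprime {a b : ℕ} (h : a.Coprime b) :
    usigma (a * b) = usigma a * usigma b := by
  unfold usigma
  rw [Nat.factorization_mul_of_coprime h, Finsupp.prod_add_index_of_disjoint]
  exact h.disjoint_primeFactors

theorem uphi_mul_of_coprime {a b : ℕ} (h : a.Coprime b) :
    uphi (a * b) = uphi a * uphi b := by
  unfold uphi
  rw [Nat.factorization_mul_of_coprime h, Finsupp.prod_add_index_of_disjoint]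
  exact h.disjoint_primeFactors

theorem usigma_eq_prod_of_subset {n : ℕ} {S : Finset ℕ} (h : n.primeFactors ⊆ S) :
    usigma n = ∏ p ∈ S,
      if n.factorization p = 0 then 1 else p ^ n.factorization p + 1 := by
  rw [usigma, Nat.prod_factorization_eq_prod_primeFactors, ← Finset.prod_subset h]
  · refine Finset.prod_congr rfl fun p hp => ?_
    rw [if_neg (Finsupp.mem_support_iff.1 hp)]
  · intro p _ hp
    rw [if_pos (Finsupp.notMem_support_iff.1 hp)]

theorem usigma_mul_le {a b : ℕ} (ha : a ≠ 0) (hb : b ≠ 0) :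
    usigma (a * b) ≤ usigma a * usigma b := by
  have hab := Nat.primeFactors_mul ha hb
  rw [usigma_eq_prod_of_subset hab.subset,
    usigma_eq_prod_of_subset (Finset.subset_union_left (s₁ := a.primeFactors)
      (s₂ := b.primeFactors)),
    usigma_eq_prod_of_subset (Finset.subset_union_right (s₁ := a.primeFactors)
      (s₂ := b.primeFactors)), ← Finset.prod_mul_distrib]
  refine Finset.prod_le_prod (fun p _ => Nat.zero_le _) fun p _ => ?_
  rw [Nat.factorization_mul ha hb, Finsupp.add_apply]
  by_cases h1 : a.factorization p = 0 <;> by_cases h2 : b.factorization p = 0 <;>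
    simp only [h1, h2, zero_add, add_zero, if_true, if_false, one_mul, mul_one, le_refl]
  rw [if_neg (by omega), pow_add]
  nlinarith [Nat.zero_le (p ^ a.factorization p), Nat.zero_le (p ^ b.factorization p)]

theorem usigma_prime_pow {p a : ℕ} (hp : p.Prime) (ha : a ≠ 0) :
    usigma (p ^ a) = p ^ a + 1 := by
  unfold usigma
  rw [hp.factorization_pow, Finsupp.prod, Finsupp.support_single _ ha]
  simp

theorem uphi_prime {p : ℕ} (hp : p.Prime) : uphi p = p - 1 := by
  unfold uphi
  rw [hp.factorization, Finsupp.prod, Finsupp.support_single _ one_ne_zero]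
  simp

theorem uphi_ne_zero (n : ℕ) : uphi n ≠ 0 := by
  rw [uphi, Finsupp.prod, Finset.prod_ne_zero_iff]
  intro p hp
  have hpp : p.Prime := Nat.prime_of_mem_primeFactors hp
  have : 1 < p ^ n.factorization p := Nat.one_lt_pow (Finsupp.mem_support_iff.1 hp) hpp.one_lt
  omega

theorem even_uphi {n p : ℕ} (hn : n ≠ 0) (hp : p.Prime) (hodd : Odd p) (hpn : p ∣ n) :
    2 ∣ uphi n := by
  have hmem : p ∈ n.factorization.support := by
    rw [Nat.support_factorization, Nat.mem_primeFactors]; exact ⟨hp, hpn, hn⟩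
  refine dvd_trans ?_ (Finset.dvd_prod_of_mem (fun p => p ^ n.factorization p - 1) hmem)
  exact (Nat.Odd.sub_odd hodd.pow odd_one).two_dvd

theorem usigma_le_mul_exp {n : ℕ} (hn : n ≠ 0) :
    (usigma n : ℝ) ≤ n * exp (∑ p ∈ n.primeFactors, (p : ℝ)⁻¹) := by
  have hprod : (n : ℝ) = ∏ p ∈ n.primeFactors, (p : ℝ) ^ n.factorization p := by
    conv_lhs => rw [← Nat.prod_factorization_pow_eq_self hn]
    rw [Nat.prod_factorization_eq_prod_primeFactors]
    push_cast
    rfl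
  conv_rhs => rw [hprod]
  rw [exp_sum, ← Finset.prod_mul_distrib, usigma, Nat.prod_factorization_eq_prod_primeFactors]
  push_cast
  refine Finset.prod_le_prod (fun p _ => by positivity) fun p hp => ?_
  have hpp : p.Prime := Nat.prime_of_mem_primeFactors hp
  have ha : n.factorization p ≠ 0 := Finsupp.mem_support_iff.1 hp
  have hp0 : (0 : ℝ) < p := by exact_mod_cast hpp.pos
  have hpa : (p : ℝ) ≤ p ^ n.factorization p :=
    le_self_pow₀ (by exact_mod_cast hpp.one_le) ha
  have h1 : (1 : ℝ) ≤ p ^ n.factorization p * (p : ℝ)⁻¹ := by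
    rw [← div_eq_mul_inv, le_div_iff₀ hp0]; linarith
  calc _ ≤ (p : ℝ) ^ n.factorization p * ((p : ℝ)⁻¹ + 1) := by linarith
    _ ≤ _ := by gcongr; exact add_one_le_exp _

theorem frequently_usigma_uphi_div_le {k p : ℕ} (hk : k ≠ 0) (hp : p.Prime) (hodd : Odd p)
    (hpk : p ∣ k) :
    ∃ᶠ n : ℕ in atTop, (usigma (uphi n) : ℝ) / n ≤ (usigma (uphi k) : ℝ) / k := by
  obtain ⟨s, u, hu, hsu⟩ := Nat.exists_eq_two_pow_mul_odd (uphi_ne_zero k)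
  have hs : s ≠ 0 := by
    rintro rfl
    have h2 := even_uphi hk hp hodd hpk
    rw [hsu, pow_zero, one_mul] at h2
    exact (Nat.not_even_iff_odd.2 hu) (even_iff_two_dvd.2 h2)
  set t : ℝ := 2 * (2 ^ s + 1) / (2 ^ (s + 1) + 1) with ht
  have ht1 : 1 < t := by
    rw [ht, lt_div_iff₀ (by positivity), pow_succ]; linarith
  rw [frequently_atTop]
  intro N
  obtain ⟨q, hq, hqN, hq4, hsum⟩ := exists_prime_sum_inv_primeFactors_le (log_pos ht1) (N + k)
  have hqk : k.Coprime q := ((hq.coprime_iff_not_dvd).2 fun h => by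
    have := Nat.le_of_dvd (Nat.pos_of_ne_zero hk) h
    omega).symm
  obtain ⟨w, hw, hwodd⟩ : ∃ w, q - 1 = 2 * w ∧ Odd w :=
    ⟨(q - 1) / 2, by omega, by rw [Nat.odd_iff]; omega⟩
  have hw0 : w ≠ 0 := by rintro rfl; exact absurd hwodd (by decide)
  have hu0 : u ≠ 0 := by rintro rfl; exact absurd hu (by decide)
  have hbound : (usigma w : ℝ) ≤ w * t := by
    refine (usigma_le_mul_exp hw0).trans ?_
    rw [← exp_log (by linarith : 0 < t)]
    gcongr
    refine le_trans (Finset.sum_le_sum_of_subset_of_nonneg (fun l hl => ?_)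
      fun _ _ _ => by positivity) hsum
    rw [Finset.mem_erase]
    refine ⟨?_, Nat.primeFactors_mono ⟨2, by rw [hw, mul_comm]⟩ (by omega) hl⟩
    rintro rfl
    exact (Nat.not_even_iff_odd.2 hwodd) (even_iff_two_dvd.2 (Nat.dvd_of_mem_primeFactors hl))
  have hk' : usigma (uphi k) = (2 ^ s + 1) * usigma u := by
    rw [hsu, usigma_mul_of_coprime (Nat.Coprime.pow_left s (Nat.coprime_two_left.2 hu)),
      usigma_prime_pow Nat.prime_two hs]
  have hkq : usigma (uphi (k * q)) ≤ (2 ^ (s + 1) + 1) * (usigma u * usigma w) := by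
    rw [uphi_mul_of_coprime hqk, uphi_prime hq, hsu, hw,
      show 2 ^ s * u * (2 * w) = 2 ^ (s + 1) * (u * w) by ring,
      usigma_mul_of_coprime (Nat.Coprime.pow_left _ (Nat.coprime_two_left.2 (hu.mul hwodd))),
      usigma_prime_pow Nat.prime_two (by omega)]
    exact Nat.mul_le_mul_left _ (usigma_mul_le hu0 hw0)
  refine ⟨k * q, by nlinarith [Nat.pos_of_ne_zero hk, hq.pos], ?_⟩
  have hk0 : (0 : ℝ) < k := by exact_mod_cast Nat.pos_of_ne_zero hk
  have hq0 : (0 : ℝ) < q := by exact_mod_cast hq.pos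
  have h2w : (2 * w : ℝ) ≤ q := by exact_mod_cast (by omega : 2 * w ≤ q)
  have hmain : (usigma (uphi (k * q)) : ℝ) ≤ usigma (uphi k) * q := by
    calc (usigma (uphi (k * q)) : ℝ) ≤ (2 ^ (s + 1) + 1) * (usigma u * usigma w) := by
          exact_mod_cast hkq
      _ ≤ (2 ^ (s + 1) + 1) * (usigma u * (w * t)) := by gcongr
      _ = (2 ^ s + 1) * usigma u * (2 * w) := by rw [ht]; field_simp
      _ ≤ (2 ^ s + 1) * usigma u * q := by gcongr
      _ = usigma (uphi k) * q := by rw [hk']; push_cast; ring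
  push_cast
  rw [div_le_div_iff₀ (by positivity) hk0]
  nlinarith

theorem liminf_usigma_uphi_le_inf :
    liminf (fun n : ℕ => (usigma (uphi n) : ℝ) / n) atTop ≤
      sInf { x : ℝ | ∃ m : ℕ, 0 < m ∧ 2 ∣ m ∧ (∀ ℓ : ℕ, 2 ≤ ℓ → m ≠ 2 ^ ℓ) ∧
        x = (usigma (uphi (m / 2)) : ℝ) / ((m / 2 : ℕ) : ℝ) } := by
  have hbdd : IsBoundedUnder (· ≥ ·) atTop (fun n : ℕ => (usigma (uphi n) : ℝ) / n) :=
    isBoundedUnder_of ⟨0, fun n => by positivity⟩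
  refine le_csInf ⟨_, 2, by norm_num, dvd_rfl, fun l hl h => ?_, rfl⟩ ?_
  · have := Nat.pow_le_pow_right (n := 2) (by norm_num) hl
    omega
  rintro x ⟨m, hm, ⟨k, rfl⟩, hpow, rfl⟩
  rw [Nat.mul_div_cancel_left k (by norm_num)]
  have hk : k ≠ 0 := by omega
  refine liminf_le_of_frequently_le ?_ hbdd
  rcases k.eq_two_pow_or_exists_odd_prime_and_dvd with ⟨j, rfl⟩ | ⟨p, hp, hpk, hodd⟩
  · rcases Nat.eq_zero_or_pos j with rfl | hj
    · have h := frequently_usigma_uphi_div_le (k := 3) (by norm_num) Nat.prime_three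
        (by decide) dvd_rfl
      have h3 : usigma (uphi 3) = 3 := by
        rw [uphi_prime Nat.prime_three]
        exact usigma_prime_pow Nat.prime_two one_ne_zero
      have h1 : usigma (uphi 1) = 1 := by simp [usigma, uphi]
      rw [h3] at h
      rw [pow_zero, h1]
      norm_num at h ⊢
      exact h
    · exact absurd (pow_succ' 2 j).symm (hpow (j + 1) (by omega))
  · exact frequently_usigma_uphi_div_le hk hp hodd hpk
end

section
/- limsup_{n→∞} σ*(φ(n))/(n · log log n) ≤ (6/π²)·e^γ, where γ is the Euler–Mascheroni constant. -/
open Filter Real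

section Mertens

open Finset Nat

lemma log_factorial_eq_sum_primesLE (n : ℕ) :
    Real.log (n ! : ℝ) = ∑ p ∈ primesLE n, ((n !).factorization p : ℝ) * Real.log p := by
  rw [Real.log_nat_eq_sum_factorization, Finsupp.sum]
  refine Finset.sum_subset (fun p hp => ?_) (fun p _ hp => ?_)
  · rw [Nat.support_factorization, Nat.mem_primeFactors] at hp
    exact mem_primesLE.2 ⟨(hp.1.dvd_factorial).1 hp.2.1, hp.1⟩
  · rw [Finsupp.notMem_support_iff.1 hp]; simp

lemma div_sub_one_le_factorization_factorial {p n : ℕ} (hp : p.Prime) (hpn : p ≤ n) :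
    (n : ℝ) / p - 1 ≤ (n !).factorization p := by
  have h1 : n / p ≤ (n !).factorization p := by
    rw [Nat.factorization_factorial hp (Nat.lt_add_one (Nat.log p n))]
    have h2 : 1 ∈ Finset.Ico 1 (Nat.log p n + 1) := by
      simp [Nat.log_pos hp.one_lt hpn]
    simpa using Finset.single_le_sum (f := fun i => n / p ^ i) (fun i _ => Nat.zero_le _) h2
  have h2 : (n : ℝ) / p < ((n / p : ℕ) : ℝ) + 1 := by
    rw [div_lt_iff₀ (by exact_mod_cast hp.pos)]
    have := Nat.lt_div_mul_add (a := n) hp.pos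
    have h3 : (n : ℝ) < ((n / p : ℕ) : ℝ) * p + p := by exact_mod_cast this
    linarith
  have h3 : ((n / p : ℕ) : ℝ) ≤ (n !).factorization p := by exact_mod_cast h1
  linarith

lemma factorization_factorial_mul_log_le {p : ℕ} (hp : p.Prime) (n : ℕ) :
    ((n !).factorization p : ℝ) * Real.log p ≤
      n * (Real.log p / p) + n * (4 * (1 / (p : ℝ) ^ (3 / 2 : ℝ))) := by
  have hp2 : (2 : ℝ) ≤ p := by exact_mod_cast hp.two_le
  have hlog : 0 ≤ Real.log p := Real.log_nonneg (by linarith)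
  have h1 : ((n !).factorization p : ℝ) ≤ n / (p - 1) := by
    calc ((n !).factorization p : ℝ) ≤ ((n / (p - 1) : ℕ) : ℝ) := by
          exact_mod_cast Nat.factorization_factorial_le_div_pred hp n
      _ ≤ (n : ℝ) / ((p - 1 : ℕ) : ℝ) := Nat.cast_div_le
      _ = n / (p - 1) := by rw [Nat.cast_sub hp.one_le, Nat.cast_one]
  have h2 : Real.log p ≤ 2 * (p : ℝ) ^ (1 / 2 : ℝ) := by
    have := Real.log_le_rpow_div (x := p) (by linarith) (ε := 1 / 2) (by norm_num)
    linarith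
  have h3 : (p : ℝ) ^ (3 / 2 : ℝ) * (p : ℝ) ^ (1 / 2 : ℝ) = (p : ℝ) ^ 2 := by
    rw [← Real.rpow_add (by linarith)]; norm_num
  have h4 : Real.log p / (p * (p - 1)) ≤ 4 * (1 / (p : ℝ) ^ (3 / 2 : ℝ)) := by
    have h5 : (0 : ℝ) < (p : ℝ) ^ (3 / 2 : ℝ) := by positivity
    rw [mul_one_div, div_le_div_iff₀ (by nlinarith) h5]
    calc Real.log p * (p : ℝ) ^ (3 / 2 : ℝ) ≤ 2 * (p : ℝ) ^ (1 / 2 : ℝ) * (p : ℝ) ^ (3 / 2 : ℝ) :=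
          mul_le_mul_of_nonneg_right h2 h5.le
      _ = 2 * (p : ℝ) ^ 2 := by rw [← h3]; ring
      _ ≤ _ := by nlinarith
  calc ((n !).factorization p : ℝ) * Real.log p ≤ n / (p - 1) * Real.log p :=
        mul_le_mul_of_nonneg_right h1 hlog
    _ = n * (Real.log p / p) + n * (Real.log p / (p * (p - 1))) := by
        have : (p : ℝ) - 1 ≠ 0 := by linarith
        field_simp
        ring
    _ ≤ _ := by gcongr

/-- **Mertens' first theorem**. -/
theorem exists_abs_sum_log_div_sub_log_le :
    ∃ C : ℝ, ∀ n : ℕ, n ≠ 0 → |∑ p ∈ primesLE n, Real.log p / p - Real.log n| ≤ C := by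
  have hsum : Summable fun k : ℕ => 4 * (1 / (k : ℝ) ^ (3 / 2 : ℝ)) :=
    (Real.summable_one_div_nat_rpow.2 (by norm_num)).mul_left 4
  set A := ∑' k : ℕ, 4 * (1 / (k : ℝ) ^ (3 / 2 : ℝ))
  refine ⟨max (Real.log 4) (1 + A), fun n hn => ?_⟩
  have hn0 : (0 : ℝ) < n := by exact_mod_cast Nat.pos_of_ne_zero hn
  set S := ∑ p ∈ primesLE n, Real.log p / p
  have upper : n * S - Real.log 4 * n ≤ n * Real.log n := by
    calc n * S - Real.log 4 * n ≤ n * S - ∑ p ∈ primesLE n, Real.log p := by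
          have h1 := Chebyshev.theta_le_log4_mul_x hn0.le
          rw [Chebyshev.theta_eq_sum_primesLE_log] at h1
          linarith
      _ = ∑ p ∈ primesLE n, ((n : ℝ) / p - 1) * Real.log p := by
          rw [Finset.mul_sum, ← Finset.sum_sub_distrib]
          exact Finset.sum_congr rfl fun p _ => by ring
      _ ≤ ∑ p ∈ primesLE n, ((n !).factorization p : ℝ) * Real.log p := by
          refine Finset.sum_le_sum fun p hp => ?_
          obtain ⟨hpn, hp⟩ := mem_primesLE.1 hp
          exact mul_le_mul_of_nonneg_right (div_sub_one_le_factorization_factorial hp hpn)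
            (Real.log_natCast_nonneg p)
      _ = Real.log (n ! : ℝ) := (log_factorial_eq_sum_primesLE n).symm
      _ ≤ Real.log ((n : ℝ) ^ n) :=
          Real.log_le_log (by positivity) (by exact_mod_cast Nat.factorial_le_pow n)
      _ = n * Real.log n := Real.log_pow _ _
  have lower : n * Real.log n - n ≤ n * S + n * A := by
    calc n * Real.log n - n ≤ Real.log (n ! : ℝ) := by
          have h1 := Stirling.le_log_factorial_stirling hn
          have h2 : 0 ≤ Real.log (2 * π) := Real.log_nonneg (by linarith [Real.pi_gt_three])
          have h3 := Real.log_natCast_nonneg n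
          linarith
      _ = ∑ p ∈ primesLE n, ((n !).factorization p : ℝ) * Real.log p :=
          log_factorial_eq_sum_primesLE n
      _ ≤ ∑ p ∈ primesLE n, (n * (Real.log p / p) + n * (4 * (1 / (p : ℝ) ^ (3 / 2 : ℝ)))) :=
          Finset.sum_le_sum fun p hp =>
            factorization_factorial_mul_log_le (prime_of_mem_primesLE hp) n
      _ = n * S + n * ∑ p ∈ primesLE n, 4 * (1 / (p : ℝ) ^ (3 / 2 : ℝ)) := by
          rw [Finset.sum_add_distrib, Finset.mul_sum, Finset.mul_sum]
      _ ≤ n * S + n * A := by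
          gcongr
          exact hsum.sum_le_tsum _ fun k _ => by positivity
  rw [abs_le]
  constructor
  · have : Real.log n - 1 ≤ S + A := le_of_mul_le_mul_left (by linarith) hn0
    linarith [le_max_right (Real.log 4) (1 + A)]
  · have : S - Real.log 4 ≤ Real.log n := le_of_mul_le_mul_left (by linarith) hn0
    linarith [le_max_left (Real.log 4) (1 + A)]

end Mertens

section ExpBlocks

open Finset Nat

/-- The primes `p` with `e ^ k < p ≤ e ^ (k + 1)`. -/
noncomputable def expBlock (k : ℕ) : Finset ℕ :=
  primesLE ⌊Real.exp ((k + 1 : ℕ) : ℝ)⌋₊ \ primesLE ⌊Real.exp (k : ℝ)⌋₊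

lemma mem_primesLE_floor_exp {x : ℝ} {p : ℕ} :
    p ∈ primesLE ⌊Real.exp x⌋₊ ↔ Real.log p ≤ x ∧ p.Prime := by
  rw [mem_primesLE]
  refine and_congr_left fun hp => ?_
  rw [Nat.le_floor_iff (Real.exp_pos x).le, Real.log_le_iff_le_exp (by exact_mod_cast hp.pos)]

lemma mem_expBlock {k p : ℕ} :
    p ∈ expBlock k ↔ p.Prime ∧ (k : ℝ) < Real.log p ∧ Real.log p ≤ k + 1 := by
  rw [expBlock, Finset.mem_sdiff, mem_primesLE_floor_exp, mem_primesLE_floor_exp]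
  push_cast
  constructor
  · rintro ⟨⟨h1, h2⟩, h3⟩
    exact ⟨h2, lt_of_not_ge fun h => h3 ⟨h, h2⟩, h1⟩
  · rintro ⟨h1, h2, h3⟩
    exact ⟨⟨h3, h1⟩, fun h => h2.not_ge h.1⟩

lemma sum_range_sum_expBlock (g : ℕ → ℝ) (K : ℕ) :
    ∑ k ∈ range K, ∑ p ∈ expBlock k, g p = ∑ p ∈ primesLE ⌊Real.exp (K : ℝ)⌋₊, g p := by
  have h : ∀ k, ∑ p ∈ expBlock k, g p = ∑ p ∈ primesLE ⌊Real.exp ((k + 1 : ℕ) : ℝ)⌋₊, g p -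
      ∑ p ∈ primesLE ⌊Real.exp (k : ℝ)⌋₊, g p := fun k =>
    Finset.sum_sdiff_eq_sub (primesLE_mono (by gcongr; simp))
  rw [Finset.sum_congr rfl fun k _ => h k,
    Finset.sum_range_sub fun k : ℕ => ∑ p ∈ primesLE ⌊Real.exp (k : ℝ)⌋₊, g p]
  simp

lemma exists_abs_sum_expBlock_log_div_sub_one_le :
    ∃ C : ℝ, ∀ K : ℕ, |∑ k ∈ range K, (∑ p ∈ expBlock k, Real.log p / p - 1)| ≤ C := by
  obtain ⟨C, hC⟩ := exists_abs_sum_log_div_sub_log_le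
  refine ⟨C + Real.log 2, fun K => ?_⟩
  rw [Finset.sum_sub_distrib, sum_range_sum_expBlock]
  have h1 : 1 ≤ Real.exp (K : ℝ) := Real.one_le_exp (by positivity)
  set N := ⌊Real.exp (K : ℝ)⌋₊
  have hN : 1 ≤ N := Nat.le_floor (by simp)
  have hN' : (1 : ℝ) ≤ N := by exact_mod_cast hN
  have h2 : Real.log N ≤ K :=
    (Real.log_le_iff_le_exp (by linarith)).2 (Nat.floor_le (Real.exp_pos _).le)
  have h3 : (K : ℝ) ≤ Real.log 2 + Real.log N := by
    rw [← Real.log_mul (by norm_num) (by linarith), Real.le_log_iff_exp_le (by linarith)]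
    have := Nat.lt_floor_add_one (Real.exp (K : ℝ))
    linarith
  have h4 := abs_le.1 (hC N (by lia))
  have h5 : 0 ≤ Real.log 2 := Real.log_nonneg (by norm_num)
  rw [abs_le]
  simp only [Finset.sum_const, Finset.card_range, nsmul_eq_mul, mul_one]
  constructor <;> linarith [h4.1, h4.2]

lemma summable_sum_expBlock_inv_sub :
    Summable fun k : ℕ =>
      ∑ p ∈ expBlock k, (1 / (p : ℝ) - 1 / (k + 1 : ℝ) * (Real.log p / p)) := by
  obtain ⟨C, hC⟩ := exists_abs_sum_expBlock_log_div_sub_one_le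
  have hl : ∀ k, ∑ p ∈ expBlock k, Real.log p / p ≤ 2 * C + 1 := fun k => by
    have h1 := abs_le.1 (hC (k + 1))
    have h2 := abs_le.1 (hC k)
    rw [Finset.sum_range_succ] at h1
    linarith [h1.1, h1.2, h2.1, h2.2]
  rw [← summable_nat_add_iff 1]
  have hs : Summable fun k : ℕ => (2 * C + 1) * (1 / ((k + 1 : ℕ) : ℝ) ^ 2) :=
    ((summable_nat_add_iff 1).2 (Real.summable_one_div_nat_pow.2 one_lt_two)).mul_left _
  refine Summable.of_nonneg_of_le (fun k => Finset.sum_nonneg fun p hp => ?_) (fun k => ?_) hs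
  · obtain ⟨hp, h1, h2⟩ := mem_expBlock.1 hp
    have hp0 : (0 : ℝ) < p := by exact_mod_cast hp.pos
    rw [sub_nonneg, _root_.div_mul_div_comm, one_mul, div_le_div_iff₀ (by positivity) hp0]
    nlinarith
  · calc ∑ p ∈ expBlock (k + 1), (1 / (p : ℝ) - 1 / (((k + 1 : ℕ) : ℝ) + 1) * (Real.log p / p))
        ≤ ∑ p ∈ expBlock (k + 1), (1 / ((k + 1 : ℕ) : ℝ) ^ 2) * (Real.log p / p) := by
          refine Finset.sum_le_sum fun p hp => ?_
          obtain ⟨hp, h1, h2⟩ := mem_expBlock.1 hp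
          have hp0 : (0 : ℝ) < p := by exact_mod_cast hp.pos
          have hk : (0 : ℝ) < ((k + 1 : ℕ) : ℝ) := by positivity
          set K : ℝ := ((k + 1 : ℕ) : ℝ)
          have h3 : 1 / Real.log p - 1 / (K + 1) ≤ 1 / K ^ 2 := by
            have h4 : 1 / Real.log p ≤ 1 / K := one_div_le_one_div_of_le hk h1.le
            have h5 : 1 / K - 1 / (K + 1) = 1 / (K * (K + 1)) := by field_simp; ring
            have h6 : 1 / (K * (K + 1)) ≤ 1 / K ^ 2 :=
              one_div_le_one_div_of_le (by positivity) (by nlinarith)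
            linarith
          have h7 : 1 / (p : ℝ) = 1 / Real.log p * (Real.log p / p) := by
            have : Real.log p ≠ 0 := by linarith
            field_simp
          rw [h7, ← sub_mul]
          exact mul_le_mul_of_nonneg_right h3 (div_nonneg (by linarith) hp0.le)
      _ = (1 / ((k + 1 : ℕ) : ℝ) ^ 2) * ∑ p ∈ expBlock (k + 1), Real.log p / p := by
          rw [Finset.mul_sum]
      _ ≤ (1 / ((k + 1 : ℕ) : ℝ) ^ 2) * (2 * C + 1) :=
          mul_le_mul_of_nonneg_left (hl _) (by positivity)
      _ = _ := mul_comm _ _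

lemma summable_sum_expBlock_inv_sub_log :
    Summable fun k : ℕ => ∑ p ∈ expBlock k, (1 / (p : ℝ) - Real.log (1 + 1 / p)) := by
  have h0 : ∀ p : ℕ, 0 ≤ 1 / (p : ℝ) - Real.log (1 + 1 / p) := fun p => by
    have h1 : (0 : ℝ) < 1 + 1 / p := by positivity
    linarith [Real.log_le_sub_one_of_pos h1]
  have hs : Summable fun k : ℕ => 1 / (k : ℝ) ^ 2 := Real.summable_one_div_nat_pow.2 one_lt_two
  refine summable_of_sum_range_le (c := ∑' k : ℕ, 1 / (k : ℝ) ^ 2)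
    (fun k => Finset.sum_nonneg fun p _ => h0 p) fun K => ?_
  rw [sum_range_sum_expBlock]
  refine le_trans (Finset.sum_le_sum fun p hp => ?_)
    (hs.sum_le_tsum (primesLE ⌊Real.exp (K : ℝ)⌋₊) fun k _ => by positivity)
  have hp0 : (0 : ℝ) < p := by exact_mod_cast (prime_of_mem_primesLE hp).pos
  have h1 : (0 : ℝ) < 1 + 1 / p := by positivity
  have h2 := Real.one_sub_inv_le_log_of_pos h1
  have h3 : 1 / (p : ℝ) - (1 - (1 + 1 / (p : ℝ))⁻¹) ≤ 1 / (p : ℝ) ^ 2 := by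
    have : 1 / (p : ℝ) - (1 - (1 + 1 / (p : ℝ))⁻¹) = 1 / ((p : ℝ) * (p + 1)) := by
      field_simp
      ring
    rw [this]
    exact one_div_le_one_div_of_le (by positivity) (by nlinarith)
  linarith

/-- A form of **Mertens' second theorem** along the sequence `e ^ K`. -/
theorem exists_tendsto_sum_expBlock_log_one_add_inv :
    ∃ l : ℝ, Tendsto (fun K => ∑ k ∈ range K,
      (∑ p ∈ expBlock k, Real.log (1 + 1 / p) - 1 / (k + 1 : ℝ))) atTop (nhds l) := by
  obtain ⟨C, hC⟩ := exists_abs_sum_expBlock_log_div_sub_one_le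
  have hanti : Antitone fun k : ℕ => 1 / (k + 1 : ℝ) := fun a b hab => by
    simp only
    gcongr
  obtain ⟨l, hl⟩ := cauchySeq_tendsto_of_complete
    (hanti.cauchySeq_series_mul_of_tendsto_zero_of_bounded
      (z := fun k => ∑ p ∈ expBlock k, Real.log p / p - 1)
      tendsto_one_div_add_atTop_nhds_zero_nat (by simpa only [Real.norm_eq_abs] using hC))
  refine ⟨_, ((hl.add summable_sum_expBlock_inv_sub.hasSum.tendsto_sum_nat).sub
    summable_sum_expBlock_inv_sub_log.hasSum.tendsto_sum_nat).congr fun K => ?_⟩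
  rw [← Finset.sum_add_distrib, ← Finset.sum_sub_distrib]
  refine Finset.sum_congr rfl fun k _ => ?_
  rw [Finset.sum_sub_distrib, Finset.sum_sub_distrib, ← Finset.mul_sum, smul_eq_mul]
  ring

end ExpBlocks

section EulerProduct

open Finset Nat Topology

lemma hasProd_one_sub_rpow_inv {s : ℝ} (hs : 1 < s) :
    HasProd (fun p : Primes => (1 - 1 / ((p : ℕ) : ℝ) ^ s)⁻¹) (∑' n : ℕ, 1 / (n : ℝ) ^ s) := by
  let f : ℕ →*₀ ℝ :=
    { toFun := fun n => 1 / (n : ℝ) ^ s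
      map_zero' := by simp [Real.zero_rpow (by linarith : s ≠ 0)]
      map_one' := by simp
      map_mul' := fun m n => by
        rw [Nat.cast_mul, Real.mul_rpow (by positivity) (by positivity)]
        field_simp }
  have hf : Summable fun n => ‖f n‖ := by
    refine (Real.summable_one_div_nat_rpow.2 hs).congr fun n => ?_
    exact (Real.norm_of_nonneg (by positivity : 0 ≤ 1 / (n : ℝ) ^ s)).symm
  exact EulerProduct.eulerProduct_completely_multiplicative_hasProd hf

lemma tsum_one_div_rpow_pos {s : ℝ} (hs : 1 < s) : 0 < ∑' n : ℕ, 1 / (n : ℝ) ^ s :=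
  (Real.summable_one_div_nat_rpow.2 hs).tsum_pos (fun _ => by positivity) 1 (by simp)

lemma hasProd_one_add_rpow {s : ℝ} (hs : 1 < s) :
    HasProd (fun p : Primes => 1 + 1 / ((p : ℕ) : ℝ) ^ s)
      ((∑' n : ℕ, 1 / (n : ℝ) ^ s) / ∑' n : ℕ, 1 / (n : ℝ) ^ (2 * s)) := by
  have h2 := tsum_one_div_rpow_pos (s := 2 * s) (by linarith)
  refine ((hasProd_one_sub_rpow_inv hs).div₀
    (hasProd_one_sub_rpow_inv (s := 2 * s) (by linarith)) h2.ne').congr_fun fun p => ?_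
  have hp : (1 : ℝ) < (p : ℕ) := by exact_mod_cast p.prop.one_lt
  have h3 : 1 < ((p : ℕ) : ℝ) ^ s := Real.one_lt_rpow hp (by linarith)
  have h4 : ((p : ℕ) : ℝ) ^ (2 * s) = (((p : ℕ) : ℝ) ^ s) ^ 2 := by
    rw [mul_comm, Real.rpow_mul (by linarith), Real.rpow_two]
  rw [h4]
  set x := ((p : ℕ) : ℝ) ^ s
  have h5 : x - 1 ≠ 0 := by linarith
  have h6 : x ^ 2 - 1 ≠ 0 := by nlinarith
  have h7 : 1 - 1 / x ≠ 0 := by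
    rw [one_sub_div (by linarith)]
    exact div_ne_zero h5 (by linarith)
  rw [div_inv_eq_mul, ← div_eq_inv_mul, eq_div_iff h7]
  ring

lemma prod_one_add_rpow_le {s : ℝ} (hs : 1 < s) {T : Finset ℕ} (hT : ∀ p ∈ T, p.Prime) :
    ∏ p ∈ T, (1 + 1 / (p : ℝ) ^ s) ≤
      (∑' n : ℕ, 1 / (n : ℝ) ^ s) / ∑' n : ℕ, 1 / (n : ℝ) ^ (2 * s) := by
  have h : ∏ p ∈ T, (1 + 1 / (p : ℝ) ^ s) =
      ∏ p ∈ T.subtype Nat.Prime, (1 + 1 / ((p : ℕ) : ℝ) ^ s) := by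
    rw [Finset.prod_subtype_of_mem (fun p : ℕ => 1 + 1 / (p : ℝ) ^ s) hT]
  rw [h]
  refine ge_of_tendsto (hasProd_one_add_rpow hs) ?_
  filter_upwards [eventually_ge_atTop (T.subtype Nat.Prime)] with U hU
  refine Finset.prod_le_prod_of_subset_of_one_le hU (fun p _ => by positivity) fun p _ _ => ?_
  have : 0 ≤ 1 / ((p : ℕ) : ℝ) ^ s := by positivity
  linarith

lemma exp_mul_log_one_add_inv_le {k p : ℕ} (hp : p ∈ expBlock k) {δ : ℝ} (h0 : 0 ≤ δ) :
    Real.log (1 + 1 / p) * Real.exp (-δ) ^ (k + 1) ≤ Real.log (1 + 1 / (p : ℝ) ^ (1 + δ)) := by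
  obtain ⟨hp, -, h1⟩ := mem_expBlock.1 hp
  have hp0 : (0 : ℝ) < p := by exact_mod_cast hp.pos
  have hp1 : (1 : ℝ) ≤ p := by exact_mod_cast hp.one_le
  set t := (p : ℝ) ^ (-δ) with ht
  have ht0 : 0 < t := by positivity
  have ht1 : t ≤ 1 := Real.rpow_le_one_of_one_le_of_nonpos hp1 (by linarith)
  have h2 : Real.exp (-δ) ^ (k + 1) ≤ t := by
    rw [← Real.exp_nat_mul, ht, Real.rpow_def_of_pos hp0, Real.exp_le_exp]
    push_cast
    nlinarith
  have h3 : 1 / (p : ℝ) ^ (1 + δ) = t * (1 / p) := by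
    rw [ht, Real.rpow_neg hp0.le, Real.rpow_add hp0, Real.rpow_one]
    field_simp
  have h4 : 0 < 1 / (p : ℝ) := by positivity
  have h5 : 0 ≤ Real.log (1 + 1 / (p : ℝ)) := Real.log_nonneg (by linarith)
  calc Real.log (1 + 1 / p) * Real.exp (-δ) ^ (k + 1) ≤ Real.log (1 + 1 / p) * t := by gcongr
    _ = Real.log ((1 + 1 / (p : ℝ)) ^ t) := by rw [Real.log_rpow (by positivity), mul_comm]
    _ ≤ Real.log (1 + t * (1 / p)) :=
        Real.log_le_log (by positivity)
          (rpow_one_add_le_one_add_mul_self (by linarith) ht0.le ht1)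
    _ = _ := by rw [h3]

lemma sum_range_mul_exp_pow_le {δ : ℝ} (hδ : 0 < δ) (K : ℕ) :
    ∑ k ∈ range K, (∑ p ∈ expBlock k, Real.log (1 + 1 / p)) * Real.exp (-δ) ^ (k + 1) ≤
      Real.log ((∑' n : ℕ, 1 / (n : ℝ) ^ (1 + δ)) / ∑' n : ℕ, 1 / (n : ℝ) ^ (2 * (1 + δ))) := by
  calc _ ≤ ∑ k ∈ range K, ∑ p ∈ expBlock k, Real.log (1 + 1 / (p : ℝ) ^ (1 + δ)) := by
        refine Finset.sum_le_sum fun k _ => ?_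
        rw [Finset.sum_mul]
        exact Finset.sum_le_sum fun p hp => exp_mul_log_one_add_inv_le hp hδ.le
    _ = Real.log (∏ p ∈ primesLE ⌊Real.exp (K : ℝ)⌋₊, (1 + 1 / (p : ℝ) ^ (1 + δ))) := by
        rw [sum_range_sum_expBlock fun p => Real.log (1 + 1 / (p : ℝ) ^ (1 + δ)),
          Real.log_prod fun p _ => by positivity]
    _ ≤ _ := Real.log_le_log (by positivity)
        (prod_one_add_rpow_le (by linarith) fun p hp => prime_of_mem_primesLE hp)

lemma tsum_mul_exp_pow_le {δ : ℝ} (hδ : 0 < δ) :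
    (∑' k : ℕ, (∑ p ∈ expBlock k, Real.log (1 + 1 / p) - 1 / (k + 1 : ℝ)) * Real.exp (-δ) ^ k) *
        Real.exp (-δ) ≤
      Real.log (δ * (∑' n : ℕ, 1 / (n : ℝ) ^ (1 + δ)) * ((1 - Real.exp (-δ)) / δ) /
        ∑' n : ℕ, 1 / (n : ℝ) ^ (2 * (1 + δ))) := by
  have hz : Real.exp (-δ) < 1 := Real.exp_lt_one_iff.2 (by linarith)
  have h1 := tsum_one_div_rpow_pos (s := 1 + δ) (by linarith)
  have h2 := tsum_one_div_rpow_pos (s := 2 * (1 + δ)) (by linarith)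
  have hlog := Real.hasSum_pow_div_log_of_abs_lt_one (x := Real.exp (-δ))
    (by rwa [abs_of_pos (Real.exp_pos _)])
  have h0 : ∀ k, 0 ≤ (∑ p ∈ expBlock k, Real.log (1 + 1 / p)) * Real.exp (-δ) ^ (k + 1) :=
    fun k => mul_nonneg (Finset.sum_nonneg fun p _ => Real.log_nonneg (by simp)) (by positivity)
  have hs := summable_of_sum_range_le h0 (sum_range_mul_exp_pow_le hδ)
  have hle := Real.tsum_le_of_sum_range_le h0 (sum_range_mul_exp_pow_le hδ)
  rw [← tsum_mul_right]
  calc _ = ∑' k : ℕ, ((∑ p ∈ expBlock k, Real.log (1 + 1 / p)) * Real.exp (-δ) ^ (k + 1) -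
          Real.exp (-δ) ^ (k + 1) / (k + 1)) := tsum_congr fun k => by ring
    _ ≤ Real.log ((∑' n : ℕ, 1 / (n : ℝ) ^ (1 + δ)) / ∑' n : ℕ, 1 / (n : ℝ) ^ (2 * (1 + δ))) +
          Real.log (1 - Real.exp (-δ)) := by
        rw [hs.tsum_sub hlog.summable, hlog.tsum_eq]
        linarith
    _ = _ := by
        rw [← Real.log_mul (div_pos h1 h2).ne' (by linarith)]
        congr 1
        field_simp

lemma tendsto_tsum_one_div_rpow_two_mul :
    Tendsto (fun δ : ℝ => ∑' n : ℕ, 1 / (n : ℝ) ^ (2 * (1 + δ))) (𝓝[>] 0) (𝓝 (π ^ 2 / 6)) := by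
  rw [← hasSum_zeta_two.tsum_eq]
  refine tendsto_tsum_of_dominated_convergence (bound := fun n : ℕ => 1 / (n : ℝ) ^ 2)
    hasSum_zeta_two.summable (fun n => ?_) ?_
  · rcases Nat.eq_zero_or_pos n with rfl | hn
    · refine tendsto_const_nhds.congr' ?_
      filter_upwards [self_mem_nhdsWithin] with δ hδ
      have : 2 * (1 + δ) ≠ 0 := by linarith [Set.mem_Ioi.1 hδ]
      simp [Real.zero_rpow this]
    · have hn0 : (0 : ℝ) < n := by exact_mod_cast hn
      have hc : ContinuousAt (fun δ : ℝ => 1 / (n : ℝ) ^ (2 * (1 + δ))) 0 := by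
        refine ContinuousAt.div continuousAt_const ?_ (by positivity)
        exact ContinuousAt.rpow continuousAt_const (by fun_prop) (Or.inl hn0.ne')
      have := hc.tendsto
      simp only [add_zero, mul_one, Real.rpow_two] at this
      exact this.mono_left nhdsWithin_le_nhds
  · filter_upwards [self_mem_nhdsWithin] with δ hδ n
    have hδ0 : 0 < δ := hδ
    rw [Real.norm_of_nonneg (by positivity)]
    rcases Nat.eq_zero_or_pos n with rfl | hn
    · simp [Real.zero_rpow (by linarith : 2 * (1 + δ) ≠ 0)]
    · have hn1 : (1 : ℝ) ≤ n := by exact_mod_cast hn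
      rw [← Real.rpow_two]
      exact one_div_le_one_div_of_le (by positivity)
        (Real.rpow_le_rpow_of_exponent_le hn1 (by linarith))

lemma tendsto_one_sub_exp_neg_div :
    Tendsto (fun δ : ℝ => (1 - Real.exp (-δ)) / δ) (𝓝[>] 0) (𝓝 1) := by
  have h : HasDerivAt (fun δ : ℝ => 1 - Real.exp (-δ)) 1 0 := by
    simpa using ((hasDerivAt_id (0 : ℝ)).neg.exp).const_sub 1
  have := (hasDerivAt_iff_tendsto_slope.1 h).mono_left
    (nhdsWithin_mono 0 fun x (hx : 0 < x) => hx.ne')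
  refine this.congr fun δ => ?_
  simp [slope_def_field]

lemma le_log_of_tendsto_sum_expBlock {l : ℝ}
    (hl : Tendsto (fun K => ∑ k ∈ range K,
      (∑ p ∈ expBlock k, Real.log (1 + 1 / p) - 1 / (k + 1 : ℝ))) atTop (𝓝 l)) :
    l ≤ Real.log (6 / π ^ 2) := by
  have hz : Tendsto (fun δ : ℝ => Real.exp (-δ)) (𝓝[>] 0) (𝓝[<] 1) := by
    refine tendsto_nhdsWithin_iff.2 ⟨?_, ?_⟩
    · have : ContinuousAt (fun δ : ℝ => Real.exp (-δ)) 0 := by fun_prop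
      simpa using this.tendsto.mono_left nhdsWithin_le_nhds
    · filter_upwards [self_mem_nhdsWithin] with δ hδ
      exact Real.exp_lt_one_iff.2 (by linarith [Set.mem_Ioi.1 hδ])
  have hleft := ((Real.tendsto_tsum_powerSeries_nhdsWithin_lt hl).comp hz).mul
    (hz.mono_right nhdsWithin_le_nhds)
  have hshift : Tendsto (fun δ : ℝ => 1 + δ) (𝓝[>] 0) (𝓝[>] 1) := by
    refine tendsto_nhdsWithin_iff.2 ⟨?_, ?_⟩
    · have : ContinuousAt (fun δ : ℝ => 1 + δ) 0 := by fun_prop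
      simpa using this.tendsto.mono_left nhdsWithin_le_nhds
    · filter_upwards [self_mem_nhdsWithin] with δ hδ
      simpa using hδ
  have hzeta : Tendsto (fun δ : ℝ => δ * ∑' n : ℕ, 1 / (n : ℝ) ^ (1 + δ)) (𝓝[>] 0) (𝓝 1) :=
    (tendsto_sub_mul_tsum_nat_rpow.comp hshift).congr fun δ => by simp
  have hright := ((hzeta.mul tendsto_one_sub_exp_neg_div).div tendsto_tsum_one_div_rpow_two_mul
    (by positivity)).log (by positivity)
  refine (mul_one l).symm.le.trans ((le_of_tendsto_of_tendsto hleft hright ?_).trans_eq ?_)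
  · filter_upwards [self_mem_nhdsWithin] with δ hδ
    exact tsum_mul_exp_pow_le hδ
  · simp

/-- A form of **Mertens' third theorem** along the sequence `e ^ K`. -/
theorem exists_tendsto_prod_one_add_inv_div :
    ∃ c : ℝ, c ≤ 6 / π ^ 2 * Real.exp Real.eulerMascheroniConstant ∧
      Tendsto (fun K : ℕ => (∏ p ∈ primesLE ⌊Real.exp (K : ℝ)⌋₊, (1 + 1 / (p : ℝ))) / K)
        atTop (𝓝 c) := by
  obtain ⟨l, hl⟩ := exists_tendsto_sum_expBlock_log_one_add_inv
  refine ⟨Real.exp (l + Real.eulerMascheroniConstant), ?_, ?_⟩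
  · have h : 0 < 6 / π ^ 2 := by positivity
    rw [Real.exp_add]
    gcongr
    exact (Real.le_log_iff_exp_le h).1 (le_log_of_tendsto_sum_expBlock hl)
  · refine (Real.continuous_exp.continuousAt.tendsto.comp
      (hl.add Real.tendsto_harmonic_sub_log)).congr' ?_
    filter_upwards [eventually_gt_atTop 0] with K hK
    have hK0 : (0 : ℝ) < K := by exact_mod_cast hK
    have hprod : 0 < ∏ p ∈ primesLE ⌊Real.exp (K : ℝ)⌋₊, (1 + 1 / (p : ℝ)) :=
      Finset.prod_pos fun p _ => by positivity
    rw [← Real.exp_log (div_pos hprod hK0), Function.comp_apply, Real.log_div hprod.ne' hK0.ne',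
      Real.log_prod fun p _ => by positivity, Finset.sum_sub_distrib,
      sum_range_sum_expBlock fun p => Real.log (1 + 1 / (p : ℝ))]
    congr 1
    simp only [harmonic, one_div]
    push_cast
    ring

end EulerProduct

section Usigma

open Finset Nat Topology

lemma usigma_le_mul_prod {m : ℕ} (hm : m ≠ 0) :
    (usigma m : ℝ) ≤ m * ∏ p ∈ m.primeFactors, (1 + 1 / (p : ℝ)) := by
  have h : (m : ℝ) = ∏ p ∈ m.primeFactors, (p : ℝ) ^ m.factorization p := by
    conv_lhs => rw [← Nat.prod_factorization_pow_eq_self hm, Finsupp.prod]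
    push_cast
    rfl
  rw [usigma, Finsupp.prod, Nat.support_factorization]
  conv_rhs => rw [h, ← Finset.prod_mul_distrib]
  push_cast
  refine Finset.prod_le_prod (fun p _ => by positivity) fun p hp => ?_
  obtain ⟨hpp, hpm, -⟩ := Nat.mem_primeFactors.1 hp
  have hp1 : (1 : ℝ) ≤ p := by exact_mod_cast hpp.one_le
  have h1 : (p : ℝ) ≤ (p : ℝ) ^ m.factorization p :=
    le_self_pow₀ hp1 (hpp.factorization_pos_of_dvd hm hpm).ne'
  have h2 : 1 ≤ (p : ℝ) ^ m.factorization p * (1 / p) := by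
    rw [mul_one_div, one_le_div (by linarith)]
    exact h1
  linarith

/-- The prime factors of `m` exceeding `y` contribute a factor of at most
`exp (log x / (y log y))`. -/
lemma prod_filter_one_add_inv_le {m : ℕ} (hm : m ≠ 0) {x y : ℝ} (hy : 1 < y) (hmx : m ≤ x) :
    ∏ p ∈ (m.primeFactors.filter fun p : ℕ => ¬ (p : ℝ) ≤ y), (1 + 1 / (p : ℝ)) ≤
      Real.exp (Real.log x / Real.log y / y) := by
  have hlogy : 0 < Real.log y := Real.log_pos hy
  have hm0 : (0 : ℝ) < m := by exact_mod_cast Nat.pos_of_ne_zero hm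
  set F := m.primeFactors.filter fun p : ℕ => ¬ (p : ℝ) ≤ y
  have hF : ∀ p ∈ F, y < p := fun p hp => not_le.1 (Finset.mem_filter.1 hp).2
  have hcard : (F.card : ℝ) ≤ Real.log x / Real.log y := by
    rw [le_div_iff₀ hlogy]
    calc (F.card : ℝ) * Real.log y = ∑ p ∈ F, Real.log y := by simp
      _ ≤ ∑ p ∈ F, Real.log p :=
          Finset.sum_le_sum fun p hp => Real.log_le_log (by linarith) (hF p hp).le
      _ = Real.log ((∏ p ∈ F, p : ℕ) : ℝ) := by
          rw [Nat.cast_prod, Real.log_prod fun p hp => by linarith [hF p hp]]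
      _ ≤ Real.log m := by
          have hpos : 0 < ∏ p ∈ F, p := Finset.prod_pos fun p hp =>
            (Nat.prime_of_mem_primeFactors (Finset.mem_filter.1 hp).1).pos
          refine Real.log_le_log (by exact_mod_cast hpos) ?_
          exact_mod_cast Nat.le_of_dvd (Nat.pos_of_ne_zero hm)
            ((Finset.prod_dvd_prod_of_subset _ _ _ (Finset.filter_subset _ _)).trans
              (Nat.prod_primeFactors_dvd m))
      _ ≤ Real.log x := Real.log_le_log hm0 hmx
  calc ∏ p ∈ F, (1 + 1 / (p : ℝ)) ≤ ∏ p ∈ F, Real.exp (1 / y) := by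
        refine Finset.prod_le_prod (fun p _ => by positivity) fun p hp => ?_
        have h1 : 1 / (p : ℝ) ≤ 1 / y := one_div_le_one_div_of_le (by linarith) (hF p hp).le
        linarith [Real.add_one_le_exp (1 / y)]
    _ = Real.exp (F.card * (1 / y)) := by rw [Finset.prod_const, ← Real.exp_nat_mul]
    _ ≤ Real.exp (Real.log x / Real.log y / y) := by
        rw [Real.exp_le_exp, mul_one_div]
        gcongr

lemma usigma_totient_div_le {n : ℕ} (hn : Real.exp (Real.exp 1) ≤ n) :
    (usigma (Nat.totient n) : ℝ) / (n * Real.log (Real.log n)) ≤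
      (∏ p ∈ primesLE ⌊Real.exp (⌈Real.log (Real.log n)⌉₊ : ℝ)⌋₊, (1 + 1 / (p : ℝ))) /
        ⌈Real.log (Real.log n)⌉₊ * (⌈Real.log (Real.log n)⌉₊ / Real.log (Real.log n)) *
          Real.exp (1 / Real.log (Real.log n)) := by
  have hn0 : (0 : ℝ) < n := (Real.exp_pos _).trans_le hn
  have hy : Real.exp 1 ≤ Real.log n := (Real.le_log_iff_exp_le hn0).2 hn
  have hy0 : 0 < Real.log n := (Real.exp_pos _).trans_le hy
  have hL : 1 ≤ Real.log (Real.log n) := (Real.le_log_iff_exp_le hy0).2 hy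
  have hy1 : 1 < Real.log n := by linarith [Real.add_one_le_exp (1 : ℝ)]
  have hm : Nat.totient n ≠ 0 := by
    have : 0 < n := by exact_mod_cast hn0
    exact (Nat.totient_pos.2 this).ne'
  have hmn : (Nat.totient n : ℝ) ≤ n := by exact_mod_cast Nat.totient_le n
  set m := Nat.totient n
  set L := Real.log (Real.log n) with hLdef
  have hK0 : (0 : ℝ) < ⌈L⌉₊ := by linarith [Nat.le_ceil L]
  set P := ∏ p ∈ primesLE ⌊Real.exp (⌈L⌉₊ : ℝ)⌋₊, (1 + 1 / (p : ℝ))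
  have hsmall : ∏ p ∈ (m.primeFactors.filter fun p : ℕ => (p : ℝ) ≤ Real.log n),
      (1 + 1 / (p : ℝ)) ≤ P := by
    refine Finset.prod_le_prod_of_subset_of_one_le (fun p hp => ?_) (fun p _ => by positivity)
      fun p _ _ => by simp
    rw [Finset.mem_filter] at hp
    have hpp := Nat.prime_of_mem_primeFactors hp.1
    refine mem_primesLE_floor_exp.2 ⟨?_, hpp⟩
    exact (Real.log_le_log (by exact_mod_cast hpp.pos) hp.2).trans (Nat.le_ceil L)
  have hlarge := prod_filter_one_add_inv_le hm hy1 hmn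
  have h1 : Real.log n / Real.log (Real.log n) / Real.log n = 1 / L := by
    rw [← hLdef]
    field_simp
  rw [h1] at hlarge
  have hP0 : 0 ≤ P := Finset.prod_nonneg fun p _ => by positivity
  have hmain : (usigma m : ℝ) ≤ n * (P * Real.exp (1 / L)) := by
    refine (usigma_le_mul_prod hm).trans (mul_le_mul hmn ?_ (by positivity) hn0.le)
    rw [← Finset.prod_filter_mul_prod_filter_not m.primeFactors
      (fun p : ℕ => (p : ℝ) ≤ Real.log n)]
    exact mul_le_mul hsmall hlarge (Finset.prod_nonneg fun p _ => by positivity) hP0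
  rw [div_le_iff₀ (by positivity)]
  refine hmain.trans_eq ?_
  field_simp

end Usigma

theorem limsup_usigma_phi_le :
    limsup (fun n : ℕ => (usigma (Nat.totient n) : ℝ) / (n * Real.log (Real.log n))) atTop
      ≤ (6 / Real.pi ^ 2) * Real.exp Real.eulerMascheroniConstant := by
  obtain ⟨c, hc, hlim⟩ := exists_tendsto_prod_one_add_inv_div
  have hL : Tendsto (fun n : ℕ => Real.log (Real.log n)) atTop atTop :=
    Real.tendsto_log_atTop.comp (Real.tendsto_log_atTop.comp tendsto_natCast_atTop_atTop)
  have hbound := ((hlim.comp (tendsto_nat_ceil_atTop.comp hL)).mul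
    ((tendsto_nat_ceil_div_atTop (R := ℝ)).comp hL)).mul
      (Real.continuous_exp.continuousAt.tendsto.comp (hL.const_div_atTop 1))
  rw [mul_one, Real.exp_zero, mul_one] at hbound
  have hle : ∀ᶠ n : ℕ in atTop, (usigma (Nat.totient n) : ℝ) / (n * Real.log (Real.log n)) ≤ _ :=
    (tendsto_natCast_atTop_atTop.eventually_ge_atTop (Real.exp (Real.exp 1))).mono
      fun n hn => usigma_totient_div_le hn
  have hnonneg : ∀ᶠ n : ℕ in atTop,
      (0 : ℝ) ≤ (usigma (Nat.totient n) : ℝ) / (n * Real.log (Real.log n)) :=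
    (hL.eventually_ge_atTop 0).mono fun n hn => by positivity
  exact (limsup_le_limsup hle
    (isBoundedUnder_of_eventually_ge hnonneg).isCoboundedUnder_le
    hbound.isBoundedUnder_le).trans (hbound.limsup_eq.trans_le hc)
end
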